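/- arXiv:2506.22317 — 4 statements merged into one kernel-verified Lean document; each statement's English description precedes it below -/
import Mathlib

section
/- Every maximal independent set of the grid Möbius strip M_{2×n} (n ≥ 3) has odd cardinality. -/
open SimpleGraph Finset

/-- A maximal independent set of a simple graph, as a `Finset` of vertices. -/
def IsMaxIndep {V : Type*} (G : SimpleGraph V) (s : Finset V) : Prop :=
  (∀ ⦃u⦄, u ∈ s → ∀ ⦃v⦄, v ∈ s → ¬ G.Adj u v) ∧
  ∀ t : Finset V, (∀ ⦃u⦄, u ∈ t → ∀ ⦃v⦄, v ∈ t → ¬ G.Adj u v) → s ⊆ t → s = t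

/-- The finite set of all maximal independent sets of `G`. -/
noncomputable def misFinset {V : Type*} [Fintype V] (G : SimpleGraph V) : Finset (Finset V) := by
  classical exact Finset.univ.filter (IsMaxIndep G)

/-- The number of orbits of maximal independent sets of `G` under the action of the
automorphism group of `G`. -/
noncomputable def nimisCard {V : Type*} [Fintype V] [DecidableEq V] (G : SimpleGraph V) : ℕ :=
  Nat.card (Quot (fun M N : {s : Finset V // IsMaxIndep G s} =>
    ∃ e : G ≃g G, (M : Finset V).image e = (N : Finset V)))

/-- The grid graph `G_{m×n}`, the box product of two path graphs. -/
def gridGraph (m n : ℕ) : SimpleGraph (Fin m × Fin n) := pathGraph m □ pathGraph n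

/-- The grid Möbius strip `M_{m×n}` on vertex set `Fin n × Fin m` (0-indexed version of
`{1,…,n} × {1,…,m}`): edges at Manhattan distance 1, plus the twisted wrap-around edges
joining `(1,i)` to `(n, m+1-i)`. -/
def mobiusGraph (m n : ℕ) : SimpleGraph (Fin n × Fin m) :=
  SimpleGraph.fromRel (fun p q =>
    ((p.1 : ℕ) + 1 = (q.1 : ℕ) ∧ p.2 = q.2) ∨
    (p.1 = q.1 ∧ (p.2 : ℕ) + 1 = (q.2 : ℕ)) ∨
    ((p.1 : ℕ) = 0 ∧ (q.1 : ℕ) = n - 1 ∧ (p.2 : ℕ) + (q.2 : ℕ) = m - 1))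

/-- A vertex outside a maximal independent set has a neighbour inside it. -/
lemma IsMaxIndep.exists_adj {V : Type*} {G : SimpleGraph V} {s : Finset V}
    (hs : IsMaxIndep G s) {v : V} (hv : v ∉ s) : ∃ u ∈ s, G.Adj v u := by
  classical
  by_contra! h
  have key := hs.2 (insert v s) (by
    intro a ha b hb hab
    rw [Finset.mem_insert] at ha hb
    rcases ha with rfl | ha <;> rcases hb with rfl | hb
    · exact G.irrefl hab
    · exact h b hb hab
    · exact h a ha hab.symm
    · exact hs.1 ha hb hab) (Finset.subset_insert v s)
  exact hv (key ▸ Finset.mem_insert_self v s)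

/-- `T` and `B` record the columns of a two-row strip, closed up with a twist, that contain a
chosen vertex in the first and in the second row respectively. If the chosen vertices are
independent and dominating and the first nonempty column has its vertex in the first row, then
the number of chosen vertices is odd: the occupied columns alternate between the rows. -/
lemma odd_sum_of_alternating (n : ℕ) (hn : 3 ≤ n) (T B : ℕ → Prop)
    [DecidablePred T] [DecidablePred B]
    (hTB : ∀ i, T i → ¬ B i)
    (hT : ∀ i, i + 1 < n → T i → ¬ T (i + 1))
    (hB : ∀ i, i + 1 < n → B i → ¬ B (i + 1))
    (hTw : T 0 → ¬ B (n - 1))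
    (hdT : ∀ i, i + 2 < n → ¬ T (i + 1) → ¬ B (i + 1) → T i ∨ T (i + 2))
    (hdB : ∀ i, i + 2 < n → ¬ T (i + 1) → ¬ B (i + 1) → B i ∨ B (i + 2))
    (h0 : ¬ T 0 → ¬ B 0 → T (n - 1))
    (hlast : ¬ T (n - 1) → ¬ B (n - 1) → T (n - 2) ∨ B 0)
    (hstart : T 0 ∨ (¬ T 0 ∧ ¬ B 0 ∧ T 1)) :
    Odd (∑ i ∈ Finset.range n, ((if T i then 1 else 0) + (if B i then 1 else 0))) := by
  have inv : ∀ i, i < n →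
      (Odd (∑ j ∈ Finset.range (i + 1), ((if T j then 1 else 0) + (if B j then 1 else 0))) ∧
        (T i ∨ (¬ T i ∧ ¬ B i ∧ 0 < i ∧ T (i - 1)))) ∨
      (Even (∑ j ∈ Finset.range (i + 1), ((if T j then 1 else 0) + (if B j then 1 else 0))) ∧
        (B i ∨ (¬ T i ∧ ¬ B i ∧ (i = 0 ∨ B (i - 1))))) := by
    intro i
    induction i with
    | zero =>
      intro _
      have := hTB 0
      rcases hstart with h | ⟨h, h', -⟩ <;> simp_all
    | succ i ih =>
      intro hi
      specialize ih (by omega)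
      rw [Finset.sum_range_succ]
      generalize (∑ j ∈ Finset.range (i + 1),
        ((if T j then 1 else 0) + (if B j then 1 else 0))) = k at ih ⊢
      have e1 := hTB (i + 1)
      have e2 := hT i hi
      have e3 := hB i hi
      have e4 := hTB i
      rw [Nat.add_sub_cancel]
      suffices h : (T (i + 1) → ¬ T i → Even k) ∧ (B (i + 1) → ¬ B i → Odd k) ∧
          (¬ T (i + 1) → ¬ B (i + 1) → Odd k ∧ T i ∨ Even k ∧ B i) by
        by_cases ht : T (i + 1)
        · have := h.1 ht (fun h' => e2 h' ht)
          simp_all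
        · by_cases hb : B (i + 1)
          · have := h.2.1 hb (fun h' => e3 h' hb)
            simp_all
          · simpa [ht, hb] using h.2.2 ht hb
      rcases i with - | i
      · clear hT hB hdT hdB hTw h0 hlast hTB
        simp only [zero_add, lt_irrefl, false_and, or_false, and_false, true_or, and_true] at *
        tauto
      · have e5 := hdT i (by omega)
        have e6 := hdB i (by omega)
        have e7 := hTB i
        clear hT hB hdT hdB hTw h0 hlast hTB hstart
        simp only [Nat.add_sub_cancel, Nat.succ_ne_zero, false_or, Nat.succ_pos, true_and] at ih
        grind
  obtain ⟨m, rfl⟩ : ∃ m, n = m + 3 := ⟨n - 3, by omega⟩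
  rcases inv (m + 2) (by omega) with h | ⟨-, h⟩
  · exact h.1
  · exfalso
    have e1 := hTB 0
    have e2 := hTB (m + 1)
    have e3 := hTB (m + 2)
    have e4 : m + 3 - 1 = m + 2 := rfl
    have e5 : m + 3 - 2 = m + 1 := rfl
    have e6 : m + 2 - 1 = m + 1 := rfl
    simp only [e4, e5, e6] at hTw h0 hlast h
    have e7 : m + 2 ≠ 0 := by omega
    clear hT hB hdT hdB inv
    tauto

theorem mis_mobius_two_by_n_odd_card (n : ℕ) (hn : 3 ≤ n)
    (M : Finset (Fin n × Fin 2)) (hM : IsMaxIndep (mobiusGraph 2 n) M) :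
    Odd M.card := by
  classical
  obtain ⟨P, hP⟩ : ∃ P : Fin 2 → ℕ → Prop, ∀ b i,
      P b i ↔ ∃ h : i < n, ((⟨i, h⟩ : Fin n), b) ∈ M := ⟨_, fun _ _ => Iff.rfl⟩
  have hcard : M.card = ∑ i ∈ Finset.range n,
      ((if P 0 i then 1 else 0) + (if P 1 i then 1 else 0)) := by
    rw [← Fin.sum_univ_eq_sum_range
      (fun i => (if P 0 i then 1 else 0) + (if P 1 i then 1 else 0)) n,
      ← congrArg Finset.card (Finset.filter_univ_mem M), Finset.card_filter,
      Fintype.sum_prod_type]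
    simp only [hP, Fin.sum_univ_two, Fin.is_lt, exists_true_left]
  have indep : ∀ i j a b, P a i → P b j → ¬ ((i + 1 = j ∧ a = b) ∨ (i = j ∧ a ≠ b) ∨
      (i = 0 ∧ j = n - 1 ∧ a ≠ b)) := by
    intro i j a b hi hj h
    obtain ⟨hi, hia⟩ := (hP a i).1 hi
    obtain ⟨hj, hjb⟩ := (hP b j).1 hj
    refine hM.1 hia hjb ?_
    simp only [mobiusGraph, SimpleGraph.fromRel_adj, ne_eq, Prod.mk.injEq, Fin.ext_iff] at h ⊢
    omega
  have dom : ∀ i a b, a ≠ b → i < n → ¬ P a i → ¬ P b i →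
      P a (i + 1) ∨ (0 < i ∧ P a (i - 1)) ∨ (i = 0 ∧ P b (n - 1)) ∨ (i = n - 1 ∧ P b 0) := by
    intro i a b hab hi hia hib
    obtain ⟨⟨⟨j, hj⟩, c⟩, hc, hadj⟩ := hM.exists_adj (v := (⟨i, hi⟩, a))
      (fun h => hia ((hP a i).2 ⟨hi, h⟩))
    replace hc := (hP c j).2 ⟨hj, hc⟩
    have hadj : (i + 1 = j ∧ c = a) ∨ (j + 1 = i ∧ c = a) ∨ (i = j ∧ c = b) ∨
        (i = 0 ∧ j = n - 1 ∧ c = b) ∨ (j = 0 ∧ i = n - 1 ∧ c = b) := by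
      simp only [mobiusGraph, SimpleGraph.fromRel_adj, ne_eq, Prod.mk.injEq, Fin.ext_iff]
        at hadj hab ⊢
      omega
    rcases hadj with ⟨rfl, rfl⟩ | ⟨rfl, rfl⟩ | ⟨rfl, rfl⟩ | ⟨rfl, rfl, rfl⟩ | ⟨rfl, rfl, rfl⟩
    · exact .inl hc
    · exact .inr (.inl ⟨by omega, hc⟩)
    · exact absurd hc hib
    · exact .inr (.inr (.inl ⟨rfl, hc⟩))
    · exact .inr (.inr (.inr ⟨rfl, hc⟩))
  have out : ∀ a i, P a i → i < n := fun a i h => ((hP a i).1 h).1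
  have odd_of_first : ∀ a b : Fin 2, a ≠ b → (P a 0 ∨ (¬ P a 0 ∧ ¬ P b 0 ∧ P a 1)) →
      Odd (∑ i ∈ Finset.range n, ((if P a i then 1 else 0) + (if P b i then 1 else 0))) := by
    intro a b hab hstart
    apply odd_sum_of_alternating n hn (P a) (P b)
    · intro i h h'
      exact indep i i a b h h' (by simp [hab])
    · intro i _ h h'
      exact indep i (i + 1) a a h h' (by simp)
    · intro i _ h h'
      exact indep i (i + 1) b b h h' (by simp)
    · intro h h'
      exact indep 0 (n - 1) a b h h' (by simp [hab])
    · intro i hi h h'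
      have := dom (i + 1) a b hab (by omega) h h'
      simp only [Nat.add_sub_cancel] at this
      rcases this with h | ⟨-, h⟩ | ⟨h, -⟩ | ⟨h, -⟩
      · exact .inr h
      · exact .inl h
      · omega
      · omega
    · intro i hi h h'
      have := dom (i + 1) b a hab.symm (by omega) h' h
      simp only [Nat.add_sub_cancel] at this
      rcases this with h | ⟨-, h⟩ | ⟨h, -⟩ | ⟨h, -⟩
      · exact .inr h
      · exact .inl h
      · omega
      · omega
    · intro h h'
      rcases dom 0 b a hab.symm (by omega) h' h with h1 | ⟨h1, -⟩ | ⟨-, h1⟩ | ⟨h1, -⟩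
      · rcases hstart with h2 | ⟨-, -, h2⟩
        · exact absurd h2 h
        · exact absurd (by simp [hab]) (indep 1 1 a b h2 h1)
      · omega
      · exact h1
      · omega
    · intro h h'
      rcases dom (n - 1) a b hab (by omega) h h' with h1 | ⟨-, h1⟩ | ⟨h1, -⟩ | ⟨-, h1⟩
      · have := out _ _ h1
        omega
      · exact .inl h1
      · omega
      · exact .inr h1
    · exact hstart
  rw [hcard]
  by_cases h0 : P 0 0
  · exact odd_of_first 0 1 (by decide) (.inl h0)
  by_cases h1 : P 1 0
  · simpa only [add_comm] using odd_of_first 1 0 (by decide) (.inl h1)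
  by_cases h2 : P 0 1
  · exact odd_of_first 0 1 (by decide) (.inr ⟨h0, h1, h2⟩)
  have h3 : P 1 1 := by
    rcases dom 0 0 1 (by decide) (by omega) h0 h1 with h | ⟨h, -⟩ | ⟨-, h⟩ | ⟨h, -⟩
    · exact absurd h h2
    · omega
    · rcases dom 0 1 0 (by decide) (by omega) h1 h0 with h' | ⟨h', -⟩ | ⟨-, h'⟩ | ⟨h', -⟩
      · exact h'
      · omega
      · exact absurd (by simp) (indep _ _ _ _ h h')
      · omega
    · omega
  simpa only [add_comm] using odd_of_first 1 0 (by decide) (.inr ⟨h1, h0, h3⟩)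
end

section
/- For n ≥ 3, let C_k(n) denote the set of k-compositions of n, i.e., k-tuples of strictly positive integers summing to n, regarded as cyclic sequences on which the dihedral group D_k of order 2k acts by cyclic rotation and reflection, and let |C_k(n)/D_k| denote the number of orbits. Then the number of orbits of maximal independent sets of the fat grid cylinder B_{2×n} under its automorphism group equals 1 + ∑_{k=1}^{⌊n/4⌋} |C_{2k}(n−2k)/D_{2k}| if n is even, and 1 + ∑_{k=1}^{⌊(n−2)/4⌋} |C_{2k+1}(n−2k−1)/D_{2k+1}| if n is odd. -/
open SimpleGraph Finset

/-- The fat grid cylinder `B_{m×n}`, the box product of a path graph and a cycle graph. -/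
def fatCylinder (m n : ℕ) : SimpleGraph (Fin m × Fin n) := pathGraph m □ cycleGraph n

/-- A `k`-composition of `n`: a `k`-tuple of strictly positive integers summing to `n`. -/
def CompTuple (k n : ℕ) : Type :=
  {f : Fin k → ℕ // (∀ i, 0 < f i) ∧ ∑ i, f i = n}

/-- Two `k`-compositions are related by the dihedral group `D_k` if one is obtained from
the other by a cyclic rotation or a reflection of the indices. -/
def dihedralRel (k n : ℕ) (f g : CompTuple k n) : Prop :=
  ∃ c : Fin k, (∀ i, g.1 i = f.1 (i + c)) ∨ (∀ i, g.1 i = f.1 (c - i))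

/-- The number of orbits of `k`-compositions of `n` under the dihedral group `D_k`. -/
noncomputable def compOrbitCount (k n : ℕ) : ℕ := Nat.card (Quot (dihedralRel k n))

/-- Two subsets of `ZMod n` agree up to a rotation or a reflection of the cycle. -/
def CycleCongr {n : ℕ} (E F : Finset (ZMod n)) : Prop :=
  ∃ c, (∀ x, x ∈ F ↔ x + c ∈ E) ∨ (∀ x, x ∈ F ↔ c - x ∈ E)

/-- The `j`-element subsets of the `n`-cycle without two consecutive elements. -/
def SparseSet (n j : ℕ) : Type :=
  {E : Finset (ZMod n) // (∀ x ∈ E, x + 1 ∉ E) ∧ E.card = j}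

/-- The number of `j`-element subsets of the `n`-cycle without two consecutive elements, up to
rotation and reflection. -/
noncomputable def sparseOrbitCount (n j : ℕ) : ℕ :=
  Nat.card (Quot fun E F : SparseSet n j => CycleCongr E.1 F.1)

theorem CycleCongr.refl {n : ℕ} (E : Finset (ZMod n)) : CycleCongr E E :=
  ⟨0, Or.inl fun x => by simp⟩

theorem CycleCongr.symm {n : ℕ} {E F : Finset (ZMod n)} (h : CycleCongr E F) :
    CycleCongr F E := by
  obtain ⟨c, h | h⟩ := h
  · exact ⟨-c, Or.inl fun x => by simp [h]⟩
  · exact ⟨c, Or.inr fun x => by simp [h]⟩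

theorem CycleCongr.trans {n : ℕ} {E F H : Finset (ZMod n)} (h : CycleCongr E F)
    (h' : CycleCongr F H) : CycleCongr E H := by
  obtain ⟨c, h | h⟩ := h <;> obtain ⟨d, h' | h'⟩ := h'
  · exact ⟨d + c, Or.inl fun x => by rw [h', h, add_assoc]⟩
  · exact ⟨d + c, Or.inr fun x => by rw [h', h, sub_add_eq_add_sub]⟩
  · exact ⟨c - d, Or.inr fun x => by rw [h', h, sub_sub, add_comm d x]⟩
  · exact ⟨c - d, Or.inl fun x => by rw [h', h, sub_sub_eq_add_sub, add_comm x, add_sub_right_comm]⟩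

theorem CycleCongr.equivalence (n j : ℕ) :
    Equivalence fun E F : SparseSet n j => CycleCongr E.1 F.1 :=
  ⟨fun E => .refl E.1, fun h => h.symm, fun h h' => h.trans h'⟩

theorem CycleCongr.card_eq {n : ℕ} {E F : Finset (ZMod n)} (h : CycleCongr E F) :
    E.card = F.card := by
  obtain ⟨c, h | h⟩ := h
  · refine (Finset.card_bij (fun x _ => x + c) (fun x hx => (h x).1 hx)
      (fun x _ y _ hxy => add_right_cancel hxy) fun y hy => ⟨y - c, ?_, by simp⟩).symm
    simpa [h] using hy
  · refine (Finset.card_bij (fun x _ => c - x) (fun x hx => (h x).1 hx)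
      (fun x _ y _ hxy => sub_right_injective hxy) fun y hy => ⟨c - y, ?_, by simp⟩).symm
    simpa [h] using hy

theorem two_mul_card_le_of_sparse {n : ℕ} [NeZero n] {E : Finset (ZMod n)}
    (h : ∀ x ∈ E, x + 1 ∉ E) : 2 * E.card ≤ n := by
  have hd : Disjoint E (E.image (· + 1)) := by
    rw [Finset.disjoint_right]
    intro y hy
    obtain ⟨x, hx, rfl⟩ := Finset.mem_image.1 hy
    exact h x hx
  have hc := Finset.card_le_univ (E ∪ E.image (· + 1))
  rw [Finset.card_union_of_disjoint hd, Finset.card_image_of_injective _ (add_left_injective 1),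
    ZMod.card] at hc
  omega

theorem sparseOrbitCount_zero (n : ℕ) : sparseOrbitCount n 0 = 1 := by
  rw [sparseOrbitCount, Nat.card_eq_one_iff_unique]
  refine ⟨⟨fun a b => ?_⟩, ⟨Quot.mk _ ⟨∅, by simp, rfl⟩⟩⟩
  induction a using Quot.ind with | mk a => ?_
  induction b using Quot.ind with | mk b => ?_
  refine congrArg _ (Subtype.ext ?_)
  rw [Finset.card_eq_zero.1 a.2.2, Finset.card_eq_zero.1 b.2.2]

theorem sparseOrbitCount_one {n : ℕ} (hn : 2 ≤ n) : sparseOrbitCount n 1 = 1 := by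
  have : Fact (1 < n) := ⟨hn⟩
  rw [sparseOrbitCount, Nat.card_eq_one_iff_unique]
  refine ⟨⟨fun a b => ?_⟩, ⟨Quot.mk _ ⟨{0}, by simp, rfl⟩⟩⟩
  induction a using Quot.ind with | mk a => ?_
  induction b using Quot.ind with | mk b => ?_
  obtain ⟨x, hx⟩ := Finset.card_eq_one.1 a.2.2
  obtain ⟨y, hy⟩ := Finset.card_eq_one.1 b.2.2
  refine Quot.sound ⟨x - y, Or.inl fun z => ?_⟩
  rw [hx, hy, Finset.mem_singleton, Finset.mem_singleton, add_sub_left_comm, add_eq_left,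
    sub_eq_zero]

theorem Int.exists_primitive (h : ℤ → ℤ) : ∃ P : ℤ → ℤ, P 0 = 0 ∧ ∀ i, P (i + 1) = P i + h i := by
  let T : Equiv.Perm (ℤ × ℤ) :=
    { toFun := fun p => (p.1 + 1, p.2 + h p.1)
      invFun := fun p => (p.1 - 1, p.2 - h (p.1 - 1))
      left_inv := fun p => by simp
      right_inv := fun p => by simp }
  have h1 : ∀ i : ℤ, (T ^ (i + 1)) (0, 0) = T ((T ^ i) (0, 0)) := fun i => by
    rw [add_comm, zpow_one_add, Equiv.Perm.mul_apply]
  have hfst : ∀ i : ℤ, ((T ^ i) (0, 0)).1 = i := by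
    intro i
    induction i using Int.induction_on with
    | zero => rfl
    | succ k ih => rw [h1]; change _ + 1 = _; rw [ih]
    | pred k ih =>
      have h2 := h1 (-(k : ℤ) - 1)
      rw [sub_add_cancel] at h2
      rw [h2] at ih
      change _ + 1 = _ at ih
      linarith
  refine ⟨fun i => ((T ^ i) (0, 0)).2, rfl, fun i => ?_⟩
  change ((T ^ (i + 1)) (0, 0)).2 = _
  rw [h1]
  change _ + h _ = _
  rw [hfst]

theorem Int.eq_add_of_forall_succ {φ : ℤ → ℤ} (h : ∀ i, φ (i + 1) = φ i + 1) (i : ℤ) :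
    φ i = i + φ 0 := by
  induction i using Int.induction_on with
  | zero => simp
  | succ k ih => rw [h, ih]; ring
  | pred k ih =>
    have := h (-(k : ℤ) - 1)
    rw [sub_add_cancel] at this
    linarith

theorem Int.eq_of_forall_succ {φ : ℤ → ℤ} (h : ∀ i, φ (i + 1) = φ i) (i : ℤ) : φ i = φ 0 := by
  have := Int.eq_add_of_forall_succ (φ := fun i => φ i + i) (fun i => by rw [h]; ring) i
  simp only [add_zero] at this
  linarith

theorem StrictMono.exists_shift_of_range_eq {P Q : ℤ → ℤ} (hP : StrictMono P) (hQ : StrictMono Q)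
    (h : Set.range Q = Set.range P) : ∃ s, ∀ i, Q i = P (i + s) := by
  have h1 : ∀ i, ∃ k, P k = Q i := fun i => by
    rw [← Set.mem_range, ← h]
    exact Set.mem_range_self i
  choose φ hφ using h1
  have hmono : StrictMono φ := fun a b hab => hP.lt_iff_lt.1 (by rw [hφ, hφ]; exact hQ hab)
  have hsurj : ∀ k, ∃ i, φ i = k := fun k => by
    obtain ⟨i, hi⟩ : P k ∈ Set.range Q := h ▸ Set.mem_range_self k
    exact ⟨i, hP.injective (by rw [hφ, hi])⟩
  refine ⟨φ 0, fun i => ?_⟩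
  rw [← Int.eq_add_of_forall_succ (fun i => ?_) i, hφ]
  obtain ⟨k, hk⟩ := hsurj (φ i + 1)
  have h2 : i < k := hmono.lt_iff_lt.1 (by omega)
  have h3 := hmono.monotone (show i + 1 ≤ k by omega)
  have h4 := hmono (show i < i + 1 by omega)
  omega

theorem Int.apply_add_mul_of_periodic {P : ℤ → ℤ} {j n : ℤ} (h : ∀ i, P (i + j) = P i + n)
    (i q : ℤ) : P (i + j * q) = P i + n * q := by
  have := Int.eq_of_forall_succ (φ := fun q => P (i + j * q) - n * q) (fun q => by
    rw [mul_add, ← add_assoc, mul_one, h]; ring) q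
  simp only [mul_zero, add_zero, sub_zero] at this
  linarith

/-- `P` lists, in increasing order, the integers whose residue lies in `E`. -/
structure Enumerates {n : ℕ} (P : ℤ → ℤ) (E : Finset (ZMod n)) : Prop where
  strictMono : StrictMono P
  mem_iff : ∀ x : ℤ, (x : ZMod n) ∈ E ↔ x ∈ Set.range P

theorem exists_enumerates {n : ℕ} [NeZero n] {E : Finset (ZMod n)} (hE : E.Nonempty) :
    ∃ P, Enumerates P E := by
  let S : Set ℤ := {x | (x : ZMod n) ∈ E}
  obtain ⟨e, he⟩ := hE
  have hn : 0 < n := Nat.pos_of_neZero n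
  obtain ⟨z, rfl⟩ := ZMod.intCast_surjective e
  have : Nonempty S := ⟨⟨z, he⟩⟩
  have : NoMaxOrder S := ⟨fun a => ⟨⟨a.1 + n, by simpa [S] using show (a.1 : ZMod n) ∈ E from a.2⟩,
    Subtype.mk_lt_mk.2 (by omega)⟩⟩
  have : NoMinOrder S := ⟨fun a => ⟨⟨a.1 - n, by simpa [S] using show (a.1 : ZMod n) ∈ E from a.2⟩,
    Subtype.mk_lt_mk.2 (by omega)⟩⟩
  classical
  let _ : LocallyFiniteOrder S := Subtype.instLocallyFiniteOrder _
  let _ : SuccOrder S := LinearLocallyFiniteOrder.succOrder S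
  let _ : PredOrder S := LinearLocallyFiniteOrder.predOrder S
  let f : S ≃o ℤ := orderIsoIntOfLinearSuccPredArch
  refine ⟨fun i => (f.symm i : ℤ), fun a b hab => f.symm.strictMono hab, fun x => ⟨fun hx => ?_, ?_⟩⟩
  · exact ⟨f ⟨x, hx⟩, by simp⟩
  · rintro ⟨i, rfl⟩
    exact (f.symm i).2

theorem Enumerates.exists_period {n : ℕ} [NeZero n] {P : ℤ → ℤ} {E : Finset (ZMod n)}
    (h : Enumerates P E) : ∀ i, P (i + E.card) = P i + n := by
  have hn : 0 < n := Nat.pos_of_neZero n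
  have hmem : ∀ i, (P i : ZMod n) ∈ E := fun i => (h.mem_iff _).2 ⟨i, rfl⟩
  obtain ⟨s, hs⟩ := h.strictMono.exists_shift_of_range_eq (Q := fun i => P i + n)
    (fun a b hab => by simpa using h.strictMono hab) (by
      ext x
      rw [← h.mem_iff]
      have : (x : ZMod n) = ((x - n : ℤ) : ZMod n) := by simp
      rw [this, h.mem_iff]
      simp [eq_sub_iff_add_eq])
  have hs0 : 0 < s := by
    have := hs 0
    rw [zero_add] at this
    exact h.strictMono.lt_iff_lt.1 (by omega)
  have hper : ∀ i, P (i + s) = P i + n := fun i => (hs i).symm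
  have hcard : E.card = s.toNat := by
    rw [← Finset.card_range s.toNat]
    refine (Finset.card_bij (fun (i : ℕ) _ => (P i : ZMod n)) (fun i _ => hmem i) ?_ ?_).symm
    · intro a ha b hb hab
      rw [Finset.mem_range] at ha hb
      wlog hlt : a ≤ b generalizing a b
      · exact (this b hb a ha hab.symm (by omega)).symm
      rw [ZMod.intCast_eq_intCast_iff_dvd_sub] at hab
      have h1 := h.strictMono.monotone (show (a : ℤ) ≤ b by omega)
      have h2 := h.strictMono (show (b : ℤ) < a + s by omega)
      rw [hper] at h2
      have h3 := Int.eq_zero_of_dvd_of_nonneg_of_lt (by omega) (by omega) hab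
      have := h.strictMono.injective (show P b = P a by omega)
      omega
    · intro x hx
      obtain ⟨z, rfl⟩ := ZMod.intCast_surjective x
      obtain ⟨i, rfl⟩ := (h.mem_iff z).1 hx
      have h0 := Int.emod_nonneg i hs0.ne'
      refine ⟨(i % s).toNat, ?_, ?_⟩
      · have := Int.emod_lt_of_pos i hs0
        rw [Finset.mem_range]
        omega
      · rw [Int.toNat_of_nonneg h0]
        conv_rhs => rw [← Int.emod_add_mul_ediv i s, Int.apply_add_mul_of_periodic hper]
        simp
  rw [hcard, Int.toNat_of_nonneg hs0.le]
  exact hper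

/-- The cyclic gaps of `E`, read from the enumeration `P`, are the entries of `f`. -/
structure GapEnumerates {n j : ℕ} (f : ZMod j → ℕ) (P : ℤ → ℤ) (E : Finset (ZMod n)) : Prop
    extends Enumerates P E where
  succ : ∀ i : ℤ, P (i + 1) = P i + (f i + 1)

theorem GapEnumerates.cycleCongr_iff {n j : ℕ} {f g : ZMod j → ℕ} {P Q : ℤ → ℤ}
    {E F : Finset (ZMod n)} (hP : GapEnumerates f P E) (hQ : GapEnumerates g Q F) :
    CycleCongr E F ↔ ∃ c, (∀ i, g i = f (i + c)) ∨ (∀ i, g i = f (c - i)) := by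
  have hf : ∀ i : ℤ, ((f i : ℕ) : ℤ) = P (i + 1) - P i - 1 := fun i => by rw [hP.succ]; ring
  have hg : ∀ i : ℤ, ((g i : ℕ) : ℤ) = Q (i + 1) - Q i - 1 := fun i => by rw [hQ.succ]; ring
  constructor
  · rintro ⟨c, h | h⟩ <;> obtain ⟨c, rfl⟩ := ZMod.intCast_surjective c
    · obtain ⟨s, hs⟩ := hP.strictMono.exists_shift_of_range_eq (Q := fun i => Q i + c)
        (fun a b hab => by simpa using hQ.strictMono hab) (by
          ext x
          have := h ((x - c : ℤ) : ZMod n)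
          rw [← Int.cast_add, sub_add_cancel, hP.mem_iff, hQ.mem_iff] at this
          rw [← this]
          simp [eq_sub_iff_add_eq])
      refine ⟨s, Or.inl fun i => ?_⟩
      obtain ⟨i, rfl⟩ := ZMod.intCast_surjective i
      zify
      rw [← Int.cast_add, hf, hg, add_right_comm, ← hs, ← hs]
      ring
    · obtain ⟨s, hs⟩ := hP.strictMono.exists_shift_of_range_eq (Q := fun i => c - Q (-i))
        (fun a b hab => by simpa using hQ.strictMono (neg_lt_neg hab)) (by
          ext x
          have := h ((c - x : ℤ) : ZMod n)
          rw [← Int.cast_sub, sub_sub_cancel, hP.mem_iff, hQ.mem_iff] at this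
          rw [← this]
          constructor
          · rintro ⟨i, rfl⟩
            exact ⟨-i, by simp⟩
          · rintro ⟨i, hi⟩
            exact ⟨-i, by simp [hi]⟩)
      refine ⟨(s : ZMod j) - 1, Or.inr fun i => ?_⟩
      obtain ⟨i, rfl⟩ := ZMod.intCast_surjective i
      zify
      rw [show (s : ZMod j) - 1 - i = ((s - 1 - i : ℤ) : ZMod j) by push_cast; rfl, hf, hg]
      have h1 := hs (-i)
      have h2 := hs (-(i + 1))
      simp only [neg_neg] at h1 h2
      rw [show s - 1 - i + 1 = -i + s by ring, show s - 1 - i = -(i + 1) + s by ring, ← h1, ← h2]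
      ring
  · rintro ⟨c, h | h⟩ <;> obtain ⟨c, rfl⟩ := ZMod.intCast_surjective c
    · have hd := Int.eq_of_forall_succ (φ := fun i => P (i + c) - Q i) (fun i => by
        have := h i
        zify at this
        rw [← Int.cast_add, hf, hg] at this
        rw [add_right_comm]
        linarith)
      generalize P (0 + c) - Q 0 = d at hd
      refine ⟨d, Or.inl fun x => ?_⟩
      obtain ⟨x, rfl⟩ := ZMod.intCast_surjective x
      rw [← Int.cast_add, hP.mem_iff, hQ.mem_iff]
      constructor
      · rintro ⟨i, rfl⟩
        exact ⟨i + c, by linarith [hd i]⟩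
      · rintro ⟨i, hi⟩
        have := hd (i - c)
        rw [sub_add_cancel] at this
        exact ⟨i - c, by linarith⟩
    · have hd := Int.eq_of_forall_succ (φ := fun i => P (c + 1 - i) + Q i) (fun i => by
        have := h i
        zify at this
        rw [← Int.cast_sub, hf, hg] at this
        rw [show c + 1 - (i + 1) = c - i by ring, show c + 1 - i = c - i + 1 by ring]
        linarith)
      generalize P (c + 1 - 0) + Q 0 = d at hd
      refine ⟨d, Or.inr fun x => ?_⟩
      obtain ⟨x, rfl⟩ := ZMod.intCast_surjective x
      rw [← Int.cast_sub, hP.mem_iff, hQ.mem_iff]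
      constructor
      · rintro ⟨i, rfl⟩
        exact ⟨c + 1 - i, by linarith [hd i]⟩
      · rintro ⟨i, hi⟩
        have := hd (c + 1 - i)
        rw [sub_sub_cancel] at this
        exact ⟨c + 1 - i, by linarith⟩

theorem GapEnumerates.sparse {n j : ℕ} {f : ZMod j → ℕ} (hf : ∀ i, 0 < f i) {P : ℤ → ℤ}
    {E : Finset (ZMod n)} (h : GapEnumerates f P E) : ∀ x ∈ E, x + 1 ∉ E := by
  intro x hx hx'
  obtain ⟨x, rfl⟩ := ZMod.intCast_surjective x
  obtain ⟨i, rfl⟩ := (h.mem_iff x).1 hx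
  obtain ⟨k, hk⟩ := (h.mem_iff (P i + 1)).1 (by exact_mod_cast hx')
  have h1 : i < k := h.strictMono.lt_iff_lt.1 (by omega)
  have h2 := h.strictMono.monotone (show i + 1 ≤ k by omega)
  have := h.succ i
  have := hf i
  omega

theorem sum_gap_eq {j : ℕ} [NeZero j] {f : ZMod j → ℕ} {P : ℤ → ℤ}
    (h : ∀ i : ℤ, P (i + 1) = P i + (f i + 1)) : P j = P 0 + (∑ i, (f i : ℤ) + j) := by
  have h1 : ∀ k : ℕ, P k = P 0 + ∑ i ∈ Finset.range k, ((f i : ℤ) + 1) := by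
    intro k
    induction k with
    | zero => simp
    | succ k ih =>
      rw [Finset.sum_range_succ, Nat.cast_add_one, h, ih, Int.cast_natCast]
      ring
  rw [h1, Finset.sum_add_distrib]
  congr 2
  · refine Finset.sum_bij (fun i _ => (i : ZMod j)) (fun _ _ => Finset.mem_univ _) ?_ ?_
      fun _ _ => rfl
    · intro a ha b hb hab
      rw [Finset.mem_range] at ha hb
      rwa [ZMod.natCast_eq_natCast_iff', Nat.mod_eq_of_lt ha, Nat.mod_eq_of_lt hb] at hab
    · intro b _
      exact ⟨b.val, Finset.mem_range.2 b.val_lt, by simp⟩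
  · simp

theorem exists_gapEnumerates_of_composition {n j : ℕ} [NeZero n] [NeZero j] (f : ZMod j → ℕ)
    (hsum : ∑ i, f i + j = n) :
    ∃ P, ∃ E : Finset (ZMod n), GapEnumerates f P E ∧ E.card = j := by
  obtain ⟨P, h0, hP⟩ := Int.exists_primitive fun i => (f i : ℤ) + 1
  have hmono : StrictMono P := strictMono_int_of_lt_succ fun i => by rw [hP]; omega
  have hper : ∀ i, P (i + j) = P i + n := fun i => by
    have := Int.eq_of_forall_succ (φ := fun i => P (i + j) - P i) (fun i => by
      rw [add_right_comm, hP, hP]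
      simp) i
    have h2 := sum_gap_eq hP
    rw [zero_add] at this
    have h3 : ∑ i, (f i : ℤ) + j = n := by exact_mod_cast hsum
    linarith
  classical
  let E : Finset (ZMod n) := Finset.univ.filter fun x => ∃ i, (P i : ZMod n) = x
  have hE : GapEnumerates f P E := by
    refine ⟨⟨hmono, fun x => ?_⟩, hP⟩
    simp only [E, Finset.mem_filter, Finset.mem_univ, true_and, Set.mem_range]
    refine ⟨fun ⟨i, hi⟩ => ?_, fun ⟨i, hi⟩ => ⟨i, by rw [hi]⟩⟩
    rw [ZMod.intCast_eq_intCast_iff_dvd_sub] at hi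
    obtain ⟨q, hq⟩ := hi
    exact ⟨i + j * q, by rw [Int.apply_add_mul_of_periodic hper]; linarith⟩
  refine ⟨P, E, hE, ?_⟩
  have h1 := hE.exists_period 0
  rw [← hper] at h1
  have := hmono.injective h1
  omega

theorem exists_composition_of_sparse {n j : ℕ} [NeZero n] [NeZero j] {E : Finset (ZMod n)}
    (hj : E.card = j) (hs : ∀ x ∈ E, x + 1 ∉ E) :
    ∃ f : ZMod j → ℕ, (∀ i, 0 < f i) ∧ ∑ i, f i + j = n ∧
      ∃ P, GapEnumerates f P E := by
  obtain ⟨P, hP⟩ := exists_enumerates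
    (Finset.card_pos.1 (hj ▸ Nat.pos_of_neZero j : 0 < E.card))
  have hper := hP.exists_period
  rw [hj] at hper
  have hmem : ∀ i, (P i : ZMod n) ∈ E := fun i => (hP.mem_iff _).2 ⟨i, rfl⟩
  have hgap : ∀ i, P i + 2 ≤ P (i + 1) := fun i => by
    have h1 := hP.strictMono (show i < i + 1 by omega)
    have h2 : P (i + 1) ≠ P i + 1 := fun h => hs _ (hmem i) (by
      have := hmem (i + 1)
      rw [h] at this
      exact_mod_cast this)
    omega
  let f : ZMod j → ℕ := fun i => (P (i.val + 1) - P i.val - 1).toNat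
  have hf : ∀ i : ℤ, P (i + 1) = P i + (f i + 1) := fun i => by
    have h1 : P (i + 1) - P i = P (i % j + 1) - P (i % j) := by
      conv_lhs => rw [← Int.emod_add_mul_ediv i j, add_right_comm,
        Int.apply_add_mul_of_periodic hper, Int.apply_add_mul_of_periodic hper]
      ring
    have h2 := hgap (i % j)
    have h3 : (f i : ℤ) = P (i % j + 1) - P (i % j) - 1 := by
      simp only [f, ZMod.val_intCast]
      omega
    omega
  refine ⟨f, fun i => ?_, ?_, P, ⟨hP, hf⟩⟩
  · have := hgap i.val
    simp only [f]
    omega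
  · have h1 := sum_gap_eq hf
    have h2 := hper 0
    rw [zero_add] at h2
    zify
    linarith

theorem sparseOrbitCount_eq {n j : ℕ} (hj : 0 < j) (hn : j ≤ n) :
    sparseOrbitCount n j = compOrbitCount j (n - j) := by
  obtain ⟨j, rfl⟩ : ∃ k, j = k + 1 := ⟨j - 1, by omega⟩
  have : NeZero n := ⟨by omega⟩
  have h1 : ∀ f : CompTuple (j + 1) (n - (j + 1)), ∃ E : SparseSet n (j + 1), ∃ P,
      GapEnumerates (j := j + 1) f.1 P E.1 := fun f => by
    obtain ⟨P, E, hE, hc⟩ := exists_gapEnumerates_of_composition (n := n) (j := j + 1) f.1 (by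
      have : ∑ i : ZMod (j + 1), f.1 i = n - (j + 1) := f.2.2
      omega)
    exact ⟨⟨E, GapEnumerates.sparse (j := j + 1) f.2.1 hE, hc⟩, P, hE⟩
  choose F P hF using h1
  have h2 : ∀ f g, CycleCongr (F f).1 (F g).1 ↔ dihedralRel _ _ f g :=
    fun f g => (hF f).cycleCongr_iff (hF g)
  symm
  refine Nat.card_congr (Equiv.ofBijective
    (Quot.map F fun f g h => (h2 f g).2 h) ⟨fun a b hab => ?_, fun a => ?_⟩)
  · induction a using Quot.ind with | mk f => ?_
    induction b using Quot.ind with | mk g => ?_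
    exact Quot.sound ((h2 f g).1
      ((Quot.eq.trans (CycleCongr.equivalence n _).eqvGen_iff).1 hab))
  · induction a using Quot.ind with | mk E => ?_
    obtain ⟨f, hpos, hsum, Q, hQ⟩ := exists_composition_of_sparse E.2.2 E.2.1
    refine ⟨Quot.mk _ ⟨f, hpos, ?_⟩,
      Quot.sound (((hF _).cycleCongr_iff hQ).2 ⟨0, Or.inl fun i => ?_⟩)⟩
    · change ∑ i : ZMod (j + 1), f i = _
      omega
    · rw [add_zero]

/-- The prism over the `n`-cycle, with rows indexed by `ZMod 2` and columns by `ZMod n`. -/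
def prismGraph (n : ℕ) : SimpleGraph (ZMod 2 × ZMod n) where
  Adj u v := u.1 ≠ v.1 ∧ u.2 = v.2 ∨ u.1 = v.1 ∧ u.2 ≠ v.2 ∧ (v.2 = u.2 + 1 ∨ u.2 = v.2 + 1)
  symm := ⟨fun u v h => by tauto⟩
  loopless := ⟨fun u h => by tauto⟩

theorem fatCylinder_two_eq_prismGraph (m : ℕ) : fatCylinder 2 (m + 3) = prismGraph (m + 3) := by
  ext u v
  have h1 : (pathGraph 2).Adj u.1 v.1 ↔ u.1 ≠ v.1 := by
    generalize u.1 = a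
    generalize v.1 = b
    revert a b
    simp only [pathGraph_adj]
    decide
  have h2 : (cycleGraph (m + 3)).Adj u.2 v.2 ↔ u.2 ≠ v.2 ∧ (v.2 = u.2 + 1 ∨ u.2 = v.2 + 1) := by
    rw [cycleGraph_adj, sub_eq_iff_eq_add', sub_eq_iff_eq_add', or_comm]
    refine ⟨fun h => ⟨?_, h⟩, And.right⟩
    rintro h'
    simp [h'] at h
  rw [fatCylinder, boxProd_adj, h1, h2, and_comm (b := u.1 = v.1)]
  exact Iff.rfl

theorem isMaxIndep_iff {V : Type*} {G : SimpleGraph V} {s : Finset V} :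
    IsMaxIndep G s ↔ (∀ u ∈ s, ∀ v ∈ s, ¬ G.Adj u v) ∧ ∀ v ∉ s, ∃ u ∈ s, G.Adj u v := by
  classical
  refine and_congr_right fun h => ⟨fun hm v hv => ?_, fun hd t ht hst => ?_⟩
  · by_contra! hc
    refine hv (hm (insert v s) ?_ (Finset.subset_insert v s) ▸ Finset.mem_insert_self v s)
    intro a ha b hb
    rw [Finset.mem_insert] at ha hb
    rcases ha with rfl | ha <;> rcases hb with rfl | hb
    · exact G.irrefl
    · exact fun hab => hc b hb hab.symm
    · exact hc a ha
    · exact h ha hb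
  · refine hst.antisymm fun v hv => ?_
    by_contra hvs
    obtain ⟨u, hu, huv⟩ := hd v hvs
    exact ht (hst hu) hv huv

theorem IsMaxIndep.image {V : Type*} [DecidableEq V] {G : SimpleGraph V} {s : Finset V}
    (h : IsMaxIndep G s) (e : G ≃g G) : IsMaxIndep G (s.image e) := by
  rw [isMaxIndep_iff] at h ⊢
  refine ⟨?_, fun v hv => ?_⟩
  · simp only [Finset.forall_mem_image, e.map_adj_iff]
    exact h.1
  · obtain ⟨w, rfl⟩ := e.surjective v
    obtain ⟨u, hu, huw⟩ := h.2 w fun hw => hv (Finset.mem_image_of_mem e hw)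
    exact ⟨e u, Finset.mem_image_of_mem e hu, e.map_adj_iff.2 huw⟩

/-- The columns of the prism that a set of vertices does not meet. -/
def emptyColumns {n : ℕ} [NeZero n] (M : Finset (ZMod 2 × ZMod n)) : Finset (ZMod n) :=
  Finset.univ.filter fun x => ∀ b, (b, x) ∉ M

/-- The vertices `(col x, x)` for `x` outside `E`. -/
def rowSet {n : ℕ} [NeZero n] (E : Finset (ZMod n)) (col : ZMod n → ZMod 2) :
    Finset (ZMod 2 × ZMod n) :=
  Finset.univ.filter fun v => v.2 ∉ E ∧ v.1 = col v.2

/-- The row `col` changes exactly when passing a column outside `E`. -/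
def Alternates {n : ℕ} (E : Finset (ZMod n)) (col : ZMod n → ZMod 2) : Prop :=
  ∀ x, col (x + 1) = col x + if x ∈ E then 0 else 1

theorem mem_emptyColumns {n : ℕ} [NeZero n] {M : Finset (ZMod 2 × ZMod n)} {x : ZMod n} :
    x ∈ emptyColumns M ↔ ∀ b, (b, x) ∉ M := by simp [emptyColumns]

theorem mem_rowSet {n : ℕ} [NeZero n] {E : Finset (ZMod n)} {col : ZMod n → ZMod 2}
    {v : ZMod 2 × ZMod n} : v ∈ rowSet E col ↔ v.2 ∉ E ∧ v.1 = col v.2 := by simp [rowSet]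

theorem emptyColumns_rowSet {n : ℕ} [NeZero n] (E : Finset (ZMod n)) (col : ZMod n → ZMod 2) :
    emptyColumns (rowSet E col) = E := by
  ext x
  simp [mem_emptyColumns, mem_rowSet]

theorem ZMod.forall_of_succ {n : ℕ} [NeZero n] {p : ZMod n → Prop} (h0 : p 0)
    (h : ∀ x, p x → p (x + 1)) (x : ZMod n) : p x := by
  have : ∀ k : ℕ, p k := fun k => by
    induction k with
    | zero => simpa using h0
    | succ k ih => simpa using h _ ih
  simpa using this x.val

theorem ZMod.exists_primitive {n : ℕ} [NeZero n] {A : Type*} [AddCommMonoid A] (h : ZMod n → A)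
    (hs : ∑ x, h x = 0) : ∃ c : ZMod n → A, ∀ x, c (x + 1) = c x + h x := by
  have hsum : ∑ i ∈ Finset.range n, h i = 0 := by
    rw [← hs]
    refine Finset.sum_bij (fun i _ => (i : ZMod n)) (fun _ _ => Finset.mem_univ _) ?_ ?_
      fun _ _ => rfl
    · intro a ha b hb hab
      rw [Finset.mem_range] at ha hb
      rwa [ZMod.natCast_eq_natCast_iff', Nat.mod_eq_of_lt ha, Nat.mod_eq_of_lt hb] at hab
    · intro b _
      exact ⟨b.val, Finset.mem_range.2 b.val_lt, by simp⟩
  refine ⟨fun x => ∑ i ∈ Finset.range x.val, h i, fun x => ?_⟩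
  have hx : h x = h (x.val : ℕ) := by simp
  beta_reduce
  rw [hx, ← Finset.sum_range_succ]
  have hx1 : (x + 1).val = (x.val + 1) % n := by
    rw [← ZMod.val_natCast]
    simp
  rcases (show x.val + 1 ≤ n from x.val_lt).lt_or_eq with hlt | heq
  · rw [hx1, Nat.mod_eq_of_lt hlt]
  · rw [hx1, heq, Nat.mod_self, hsum, Finset.sum_range_zero]

theorem ZMod.sum_indicator_compl {n : ℕ} [NeZero n] (E : Finset (ZMod n)) :
    ∑ x, (if x ∈ E then 0 else 1 : ZMod 2) = ((n + E.card : ℕ) : ZMod 2) := by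
  have h1 : (∑ x, (if x ∈ E then 0 else 1 : ZMod 2)) + ∑ x, (if x ∈ E then 1 else 0 : ZMod 2) =
      n := by
    rw [← Finset.sum_add_distrib]
    trans ∑ x : ZMod n, (1 : ZMod 2)
    · exact Finset.sum_congr rfl fun x _ => by split <;> simp
    · simp
  have h2 : ∑ x, (if x ∈ E then 1 else 0 : ZMod 2) = E.card := by simp
  rw [h2] at h1
  rw [Nat.cast_add, ← h1, add_assoc, CharTwo.add_self_eq_zero, add_zero]

theorem exists_alternates_iff {n : ℕ} [NeZero n] (E : Finset (ZMod n)) :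
    (∃ col, Alternates E col) ↔ Even (n + E.card) := by
  rw [← ZMod.natCast_eq_zero_iff_even, ← ZMod.sum_indicator_compl]
  refine ⟨fun ⟨col, h⟩ => ?_, fun h => ZMod.exists_primitive _ h⟩
  have h1 : ∑ x, col (x + 1) = ∑ x, col x := Equiv.sum_comp (Equiv.addRight (1 : ZMod n)) col
  simp only [h _, Finset.sum_add_distrib] at h1
  simpa using h1

theorem ZMod.two_cases (a : ZMod 2) : a = 0 ∨ a = 1 := by
  revert a; decide

theorem ZMod.two_ne_iff {a b : ZMod 2} : a ≠ b ↔ a = b + 1 := by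
  revert a b; decide

theorem isMaxIndep_rowSet {n : ℕ} [NeZero n] (hn : 3 ≤ n) {E : Finset (ZMod n)}
    {col : ZMod n → ZMod 2} (hs : ∀ x ∈ E, x + 1 ∉ E) (hc : Alternates E col) :
    IsMaxIndep (prismGraph n) (rowSet E col) := by
  have : Fact (1 < n) := ⟨by omega⟩
  rw [isMaxIndep_iff]
  refine ⟨?_, ?_⟩
  · rintro ⟨a, x⟩ hu ⟨b, y⟩ hv hadj
    rw [mem_rowSet] at hu hv
    obtain ⟨hx, ha⟩ := hu
    obtain ⟨hy, hb⟩ := hv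
    dsimp only at hx ha hy hb
    subst ha hb
    rcases hadj with ⟨h1, h2⟩ | ⟨h1, h2, h3 | h3⟩
    · exact h1 (congrArg col h2)
    · dsimp only at h1 h3
      subst h3
      rw [hc, if_neg hx] at h1
      simp at h1
    · dsimp only at h1 h3
      subst h3
      rw [hc, if_neg hy] at h1
      simp at h1
  · rintro ⟨a, x⟩ hv
    rw [mem_rowSet] at hv
    dsimp only at hv
    by_cases hx : x ∈ E
    · have hp : x - 1 ∉ E := fun h => hs _ h (by simpa using hx)
      have h1 := hc (x - 1)
      rw [if_neg hp, sub_add_cancel] at h1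
      have h2 := hc x
      rw [if_pos hx, add_zero] at h2
      by_cases ha : a = col x
      · exact ⟨(col (x + 1), x + 1), mem_rowSet.2 ⟨hs x hx, rfl⟩,
          Or.inr ⟨by simp [h2, ha], by simp, Or.inr rfl⟩⟩
      · refine ⟨(col (x - 1), x - 1), mem_rowSet.2 ⟨hp, rfl⟩,
          Or.inr ⟨?_, by simp, Or.inl (by simp)⟩⟩
        rw [← ne_eq, ZMod.two_ne_iff] at ha
        simp only [ha, h1, add_assoc, CharTwo.add_self_eq_zero, add_zero]
    · refine ⟨(col x, x), mem_rowSet.2 ⟨hx, rfl⟩, Or.inl ⟨fun h => hv ⟨hx, h.symm⟩, rfl⟩⟩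

theorem IsMaxIndep.exists_rowSet {n : ℕ} [NeZero n] (hn : 3 ≤ n)
    {M : Finset (ZMod 2 × ZMod n)} (hM : IsMaxIndep (prismGraph n) M) :
    (∀ x ∈ emptyColumns M, x + 1 ∉ emptyColumns M) ∧
      ∃ col, Alternates (emptyColumns M) col ∧ M = rowSet (emptyColumns M) col := by
  have : Fact (1 < n) := ⟨by omega⟩
  rw [isMaxIndep_iff] at hM
  obtain ⟨hind, hdom⟩ := hM
  have hnb : ∀ x ∈ emptyColumns M, ∀ b, (b, x + 1) ∈ M ∨ (b, x - 1) ∈ M := by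
    intro x hx b
    obtain ⟨⟨a, y⟩, hy, hadj⟩ := hdom (b, x) (mem_emptyColumns.1 hx b)
    rcases hadj with ⟨-, h2⟩ | ⟨h1, -, h3 | h3⟩
    · dsimp only at h2
      subst h2
      exact absurd hy (mem_emptyColumns.1 hx a)
    · dsimp only at h1 h3
      subst h1 h3
      exact Or.inr (by simpa using hy)
    · dsimp only at h1 h3
      subst h1 h3
      exact Or.inl hy
  have hcol : ∀ x a b, (a, x) ∈ M → (b, x) ∈ M → a = b := fun x a b ha hb => by
    by_contra hab
    exact hind _ ha _ hb (Or.inl ⟨hab, rfl⟩)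
  have hstep : ∀ x a b, (a, x) ∈ M → (b, x + 1) ∈ M → b = a + 1 := fun x a b ha hb => by
    rw [← ZMod.two_ne_iff]
    exact fun hab => hind _ ha _ hb (Or.inr ⟨hab.symm, by simp, Or.inl rfl⟩)
  have hsp : ∀ x ∈ emptyColumns M, x + 1 ∉ emptyColumns M := by
    intro x hx hx'
    rw [mem_emptyColumns] at hx'
    have h0 := (hnb x hx 0).resolve_left (hx' 0)
    have h1 := (hnb x hx 1).resolve_left (hx' 1)
    exact absurd (hcol _ _ _ h0 h1) (by decide)
  have hrow : ∀ x, ∃ b, (x ∉ emptyColumns M → (b, x) ∈ M) ∧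
      (x ∈ emptyColumns M → (b, x + 1) ∈ M) := by
    intro x
    by_cases hx : x ∈ emptyColumns M
    · have h1 := hsp x hx
      rw [mem_emptyColumns] at h1
      push Not at h1
      obtain ⟨b, hb⟩ := h1
      exact ⟨b, fun h => absurd hx h, fun _ => hb⟩
    · have h1 := hx
      rw [mem_emptyColumns] at h1
      push Not at h1
      obtain ⟨b, hb⟩ := h1
      exact ⟨b, fun _ => hb, fun h => absurd h hx⟩
  choose col hc1 hc2 using hrow
  refine ⟨hsp, col, fun x => ?_, ?_⟩
  · by_cases hx : x ∈ emptyColumns M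
    · rw [if_pos hx, add_zero]
      exact hcol _ _ _ (hc1 _ (hsp x hx)) (hc2 x hx)
    · rw [if_neg hx]
      by_cases hx' : x + 1 ∈ emptyColumns M
      · have h1 := hnb (x + 1) hx' (col x + 1)
        rw [add_sub_cancel_right] at h1
        refine hcol _ _ _ (hc2 _ hx') (h1.resolve_right fun h => ?_)
        exact absurd (hcol _ _ _ (hc1 x hx) h) (by simp)
      · exact hstep x _ _ (hc1 x hx) (hc1 _ hx')
  · ext ⟨a, x⟩
    rw [mem_rowSet]
    refine ⟨fun h => ?_, fun ⟨h, ha⟩ => ?_⟩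
    swap
    · obtain rfl : a = col x := ha
      exact hc1 x h
    have hx : x ∉ emptyColumns M := fun hx => mem_emptyColumns.1 hx a h
    exact ⟨hx, hcol _ _ _ h (hc1 x hx)⟩

/-- Swap the rows of the prism according to `t`, and move the columns by a cycle automorphism. -/
def prismIso {n : ℕ} (t : ZMod 2) (σ : ZMod n ≃ ZMod n)
    (hσ : (∀ x, σ (x + 1) = σ x + 1) ∨ ∀ x, σ (x + 1) + 1 = σ x) :
    prismGraph n ≃g prismGraph n where
  toEquiv := (Equiv.addRight t).prodCongr σ
  map_rel_iff' := by
    rintro ⟨a, x⟩ ⟨b, y⟩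
    rcases hσ with hσ | hσ
    · simp [prismGraph, ← hσ]
    · have h1 : ∀ x y, σ x = σ y + 1 ↔ y = x + 1 := fun x y => by
        have := hσ (y - 1)
        rw [sub_add_cancel] at this
        rw [this, σ.apply_eq_iff_eq, eq_sub_iff_add_eq, eq_comm]
      simp [prismGraph, h1, or_comm]

theorem exists_iso_of_cycleCongr {n : ℕ} [NeZero n] (hn : 3 ≤ n) {M N : Finset (ZMod 2 × ZMod n)}
    (hM : IsMaxIndep (prismGraph n) M) (hN : IsMaxIndep (prismGraph n) N)
    (h : CycleCongr (emptyColumns M) (emptyColumns N)) :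
    ∃ e : prismGraph n ≃g prismGraph n, M.image e = N := by
  obtain ⟨σ, hσ, hmem⟩ : ∃ σ : ZMod n ≃ ZMod n,
      ((∀ x, σ (x + 1) = σ x + 1) ∨ ∀ x, σ (x + 1) + 1 = σ x) ∧
      ∀ x, σ x ∈ emptyColumns N ↔ x ∈ emptyColumns M := by
    obtain ⟨c, h | h⟩ := h.symm
    · exact ⟨Equiv.addRight c, Or.inl fun x => add_right_comm x 1 c, fun x => (h x).symm⟩
    · refine ⟨Equiv.subLeft c, Or.inr fun x => ?_, fun x => (h x).symm⟩
      simp [← sub_sub]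
  have hM' := hM.image (prismIso 0 σ hσ)
  have hE : emptyColumns (M.image (prismIso 0 σ hσ)) = emptyColumns N := by
    ext y
    obtain ⟨x, rfl⟩ := σ.surjective y
    rw [hmem]
    rw [mem_emptyColumns, mem_emptyColumns]
    refine forall_congr' fun b => not_congr ⟨fun h => ?_, fun h => ?_⟩
    · obtain ⟨⟨a, y⟩, hy, heq⟩ := Finset.mem_image.1 h
      obtain ⟨h1, h2⟩ := Prod.ext_iff.1 heq
      obtain rfl : a = b := (add_zero a).symm.trans h1
      obtain rfl : y = x := σ.injective h2
      exact hy
    · exact Finset.mem_image.2 ⟨(b, x), h, Prod.ext (add_zero b) rfl⟩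
  obtain ⟨-, col, hcol, hMc⟩ := hM'.exists_rowSet hn
  obtain ⟨-, col', hcol', hNc⟩ := hN.exists_rowSet hn
  rw [hE] at hcol hMc
  generalize emptyColumns N = E at hcol hcol' hMc hNc
  have hdiff : ∀ x, col' x = col x + (col' 0 + col 0) :=
    ZMod.forall_of_succ (by rw [add_left_comm, CharTwo.add_self_eq_zero, add_zero]) fun x hx => by
      rw [hcol, hcol', hx]; ring
  refine ⟨(prismIso 0 σ hσ).trans (prismIso (col' 0 + col 0) (Equiv.refl _) (Or.inl fun _ => rfl)),
    ?_⟩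
  rw [show ∀ e f : prismGraph n ≃g prismGraph n, ⇑(e.trans f) = f ∘ e from fun _ _ => rfl,
    ← Finset.image_image, hMc, hNc]
  ext ⟨a, x⟩
  simp only [Finset.mem_image, mem_rowSet]
  constructor
  · rintro ⟨⟨b, y⟩, ⟨hy, hb⟩, heq⟩
    obtain rfl : y = x := congrArg Prod.snd heq
    have ha : b + (col' 0 + col 0) = a := congrArg Prod.fst heq
    exact ⟨hy, by rw [← ha, hdiff y]; exact congrArg (· + _) hb⟩
  · rintro ⟨hx, ha⟩
    exact ⟨(col x, x), ⟨hx, rfl⟩, Prod.ext (by rw [ha, hdiff x]; rfl) rfl⟩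

theorem IsMaxIndep.card_add {n : ℕ} [NeZero n] (hn : 3 ≤ n)
    {M : Finset (ZMod 2 × ZMod n)} (hM : IsMaxIndep (prismGraph n) M) :
    M.card + (emptyColumns M).card = n := by
  obtain ⟨-, col, -, h⟩ := hM.exists_rowSet hn
  have h1 : M.card = ((emptyColumns M)ᶜ).card := by
    generalize emptyColumns M = E at h
    subst h
    refine (Finset.card_bij (fun x _ => (col x, x)) (fun x hx => ?_) ?_ ?_).symm
    · simpa [mem_rowSet] using hx
    · intro a _ b _ hab
      exact (Prod.ext_iff.1 hab).2
    · rintro ⟨a, x⟩ hx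
      rw [mem_rowSet] at hx
      exact ⟨x, by simpa using hx.1, Prod.ext hx.2.symm rfl⟩
  have h2 := Finset.card_compl_add_card (emptyColumns M)
  rw [ZMod.card] at h2
  omega

theorem prismGraph_rung_iff {n : ℕ} (hn : 3 ≤ n) (h4 : n ≠ 4) {u v : ZMod 2 × ZMod n} :
    u.1 ≠ v.1 ∧ u.2 = v.2 ↔ (prismGraph n).Adj u v ∧
      ∀ w, (prismGraph n).Adj u w → w ≠ v →
        ∃ z, (prismGraph n).Adj v z ∧ z ≠ u ∧ (prismGraph n).Adj w z := by
  have : Fact (1 < n) := ⟨by omega⟩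
  have hz2 : (2 : ZMod n) ≠ 0 := fun h => by
    have := Nat.le_of_dvd (by norm_num) ((ZMod.natCast_eq_zero_iff 2 n).1 h)
    omega
  have hz4 : (4 : ZMod n) ≠ 0 := fun h => by
    have h1 := (ZMod.natCast_eq_zero_iff 4 n).1 h
    have := Nat.le_of_dvd (by norm_num) h1
    interval_cases n <;> omega
  obtain ⟨a, x⟩ := u
  obtain ⟨b, y⟩ := v
  constructor
  · rintro ⟨hab, rfl : x = y⟩
    refine ⟨Or.inl ⟨hab, rfl⟩, ?_⟩
    rintro ⟨c, z⟩ (⟨h1, rfl : x = z⟩ | ⟨rfl : a = c, h2, h3⟩) hne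
    · refine absurd ?_ hne
      rw [ZMod.two_ne_iff] at hab h1
      exact Prod.ext (add_right_cancel (h1.symm.trans hab)) rfl
    · exact ⟨(b, z), Or.inr ⟨rfl, h2, h3⟩, fun h => hab (congrArg Prod.fst h).symm,
        Or.inl ⟨hab, rfl⟩⟩
  · rintro ⟨h | ⟨rfl : a = b, h2, h3 | h3⟩, h⟩
    · exact h
    · obtain rfl : y = x + 1 := h3
      obtain ⟨⟨c, z⟩, hz1, hzu, hz⟩ := h (a, x - 1)
        (Or.inr ⟨rfl, by simp [eq_sub_iff_add_eq], Or.inr (by simp)⟩)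
        fun h => hz2 (by linear_combination -(congrArg Prod.snd h))
      exfalso
      rcases hz1 with ⟨h1, rfl : x + 1 = z⟩ | ⟨rfl : a = c, -, h1⟩ <;>
        rcases hz with ⟨h5, h6⟩ | ⟨h5, -, h6⟩ <;> dsimp only at *
      · exact hz2 (by linear_combination -h6)
      · exact h1 h5
      · exact h5 rfl
      · rcases h1 with rfl | h1
        · rcases h6 with h6 | h6
          · exact hz2 (by linear_combination h6)
          · exact hz4 (by linear_combination -h6)
        · exact hzu (Prod.ext rfl (add_right_cancel h1.symm))
    · obtain rfl : x = y + 1 := h3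
      obtain ⟨⟨c, z⟩, hz1, hzu, hz⟩ := h (a, y + 1 + 1) (Or.inr ⟨rfl, by simp, Or.inl rfl⟩)
        fun h => hz2 (by linear_combination congrArg Prod.snd h)
      exfalso
      rcases hz1 with ⟨h1, rfl : y = z⟩ | ⟨rfl : a = c, -, h1⟩ <;>
        rcases hz with ⟨h5, h6⟩ | ⟨h5, -, h6⟩ <;> dsimp only at *
      · exact hz2 (by linear_combination h6)
      · exact h1 h5
      · exact h5 rfl
      · rcases h1 with rfl | rfl
        · exact hzu rfl
        · rcases h6 with h6 | h6
          · exact hz4 (by linear_combination -h6)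
          · exact hz2 (by linear_combination h6)

theorem cycleCongr_image_of_ne_four {n : ℕ} [NeZero n] (hn : 3 ≤ n) (h4 : n ≠ 4)
    (M : Finset (ZMod 2 × ZMod n)) (e : prismGraph n ≃g prismGraph n) :
    CycleCongr (emptyColumns M) (emptyColumns (M.image e)) := by
  have hz2 : (2 : ZMod n) ≠ 0 := fun h => by
    have := Nat.le_of_dvd (by norm_num) ((ZMod.natCast_eq_zero_iff 2 n).1 h)
    omega
  have : Fact (1 < n) := ⟨by omega⟩
  have hrung : ∀ u v, ((e u).1 ≠ (e v).1 ∧ (e u).2 = (e v).2) ↔ u.1 ≠ v.1 ∧ u.2 = v.2 := by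
    intro u v
    rw [prismGraph_rung_iff hn h4, prismGraph_rung_iff hn h4, e.map_adj_iff,
      e.surjective.forall]
    refine and_congr_right' (forall_congr' fun w => ?_)
    rw [e.surjective.exists]
    simp only [e.map_adj_iff, e.injective.ne_iff]
  let σ : ZMod n → ZMod n := fun x => (e (0, x)).2
  have hσ : ∀ b x, (e (b, x)).2 = σ x := fun b x => by
    rcases ZMod.two_cases b with rfl | rfl
    · rfl
    · exact ((hrung (1, x) (0, x)).2 ⟨one_ne_zero, rfl⟩).2
  have hinj : Function.Injective σ := fun x y hxy => by
    by_cases h : (e (0, x)).1 = (e (0, y)).1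
    · exact congrArg Prod.snd (e.injective (Prod.ext h hxy))
    · exact ((hrung _ _).1 ⟨h, hxy⟩).2
  have hstep : ∀ x, σ (x + 1) = σ x + 1 ∨ σ x = σ (x + 1) + 1 := fun x => by
    have hadj : (prismGraph n).Adj (0, x) (0, x + 1) := Or.inr ⟨rfl, by simp, Or.inl rfl⟩
    rcases e.map_adj_iff.2 hadj with h | ⟨-, -, h⟩
    · exact absurd rfl ((hrung _ _).1 h).1
    · exact h
  have hne : ∀ x, σ (x + 1 + 1) ≠ σ x := fun x h => by
    have := hinj h
    rw [add_assoc, add_eq_left, one_add_one_eq_two] at this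
    exact hz2 this
  have hmem : ∀ x, σ x ∈ emptyColumns (M.image e) ↔ x ∈ emptyColumns M := fun x => by
    rw [mem_emptyColumns, mem_emptyColumns]
    refine ⟨fun h b hb => h (e (b, x)).1 ?_, fun h c hc => ?_⟩
    · rw [← hσ b x]
      exact Finset.mem_image_of_mem e hb
    · obtain ⟨⟨b, y⟩, hy, heq⟩ := Finset.mem_image.1 hc
      have h1 := hσ b y
      rw [heq] at h1
      obtain rfl := hinj h1
      exact h b hy
  refine CycleCongr.symm ?_
  rcases hstep 0 with h0 | h0
  · have h1 : ∀ x, σ (x + 1) = σ x + 1 := ZMod.forall_of_succ h0 fun x hx => by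
      refine (hstep (x + 1)).resolve_right fun h => hne x ?_
      linear_combination hx - h
    have h2 : ∀ x, σ x = x + σ 0 := ZMod.forall_of_succ (zero_add _).symm fun x hx => by
      rw [h1, hx, add_right_comm]
    exact ⟨σ 0, Or.inl fun x => by rw [← h2, hmem]⟩
  · have h1 : ∀ x, σ x = σ (x + 1) + 1 := ZMod.forall_of_succ h0 fun x hx => by
      refine (hstep (x + 1)).resolve_left fun h => hne x ?_
      linear_combination h - hx
    have h2 : ∀ x, σ x = σ 0 - x := ZMod.forall_of_succ (sub_zero _).symm fun x hx => by
      linear_combination hx - h1 x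
    exact ⟨σ 0, Or.inr fun x => by rw [← h2, hmem]⟩

instance {m : ℕ} (E F : Finset (ZMod (m + 1))) : Decidable (CycleCongr E F) :=
  inferInstanceAs (Decidable (∃ c, (∀ x, x ∈ F ↔ x + c ∈ E) ∨ (∀ x, x ∈ F ↔ c - x ∈ E)))

set_option maxRecDepth 100000 in
theorem cycleCongr_four : ∀ E F : Finset (ZMod 4), (∀ x ∈ E, x + 1 ∉ E) → (∀ x ∈ F, x + 1 ∉ F) →
    E.card = F.card → CycleCongr E F := by
  decide

theorem IsMaxIndep.cycleCongr_image {n : ℕ} [NeZero n] (hn : 3 ≤ n)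
    {M : Finset (ZMod 2 × ZMod n)} (hM : IsMaxIndep (prismGraph n) M)
    (e : prismGraph n ≃g prismGraph n) :
    CycleCongr (emptyColumns M) (emptyColumns (M.image e)) := by
  by_cases h4 : n = 4
  · subst h4
    have hN := hM.image e
    refine cycleCongr_four _ _ (hM.exists_rowSet hn).1 (hN.exists_rowSet hn).1 ?_
    have h1 := hM.card_add hn
    have h2 := hN.card_add hn
    rw [Finset.card_image_of_injective _ e.injective] at h2
    omega
  · exact cycleCongr_image_of_ne_four hn h4 M e

theorem nimisCard_prismGraph {n : ℕ} [NeZero n] (hn : 3 ≤ n) (J : Finset ℕ)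
    (hJ : ∀ j ∈ J, Even (n + j)) (hJ' : ∀ j, 2 * j ≤ n → Even (n + j) → j ∈ J) :
    nimisCard (prismGraph n) = ∑ j ∈ J, sparseOrbitCount n j := by
  have hF : ∀ (j : J) (E : SparseSet n j),
      ∃ M : {s // IsMaxIndep (prismGraph n) s}, emptyColumns M.1 = E.1 := fun j E => by
    obtain ⟨col, hcol⟩ := (exists_alternates_iff E.1).2 (E.2.2.symm ▸ hJ j j.2)
    exact ⟨⟨_, isMaxIndep_rowSet hn E.2.1 hcol⟩, emptyColumns_rowSet _ _⟩
  choose F hF using hF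
  have hiff : ∀ M N : {s // IsMaxIndep (prismGraph n) s},
      (∃ e : prismGraph n ≃g prismGraph n, M.1.image e = N.1) ↔
        CycleCongr (emptyColumns M.1) (emptyColumns N.1) := fun M N =>
    ⟨fun ⟨e, he⟩ => he ▸ M.2.cycleCongr_image hn e, exists_iso_of_cycleCongr hn M.2 N.2⟩
  have hequiv : Equivalence fun M N : {s // IsMaxIndep (prismGraph n) s} =>
      ∃ e : prismGraph n ≃g prismGraph n, M.1.image e = N.1 := by
    simp only [hiff]
    exact ⟨fun M => .refl _, fun h => h.symm, fun h h' => h.trans h'⟩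
  have hfin : ∀ j, Finite (SparseSet n j) := fun j => Subtype.finite
  rw [← Finset.sum_coe_sort J]
  simp only [sparseOrbitCount]
  rw [← Nat.card_sigma]
  refine (Nat.card_congr (Equiv.ofBijective (fun q => q.2.map (F q.1) fun E E' h => by
    rw [hiff, hF, hF]
    exact h) ⟨?_, fun q => ?_⟩)).symm
  · rintro ⟨j, p⟩ ⟨k, q⟩ h
    induction p using Quot.ind with | mk E => ?_
    induction q using Quot.ind with | mk E' => ?_
    have h1 := (hiff _ _).1 ((Quot.eq.trans hequiv.eqvGen_iff).1 h)
    rw [hF, hF] at h1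
    have h2 := h1.card_eq
    rw [E.2.2, E'.2.2] at h2
    obtain rfl : j = k := Subtype.ext h2
    exact congrArg (Sigma.mk j) (Quot.sound h1)
  · induction q using Quot.ind with | mk M => ?_
    obtain ⟨hs, col, hcol, -⟩ := M.2.exists_rowSet hn
    let j : J := ⟨_, hJ' _ (two_mul_card_le_of_sparse hs) ((exists_alternates_iff _).1 ⟨col, hcol⟩)⟩
    let E : SparseSet n j := ⟨_, hs, rfl⟩
    refine ⟨⟨j, Quot.mk _ E⟩, Quot.sound ((hiff _ _).2 ?_)⟩
    rw [hF]
    exact .refl _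

theorem nimis_fatCylinder_two_by_n (n : ℕ) (hn : 3 ≤ n) :
    nimisCard (fatCylinder 2 n) =
      if Even n then
        1 + ∑ k ∈ Finset.Icc 1 (n / 4), compOrbitCount (2 * k) (n - 2 * k)
      else
        1 + ∑ k ∈ Finset.Icc 1 ((n - 2) / 4), compOrbitCount (2 * k + 1) (n - (2 * k + 1)) := by
  obtain ⟨m, rfl⟩ : ∃ m, n = m + 3 := ⟨n - 3, by omega⟩
  have key : ∀ (J : Finset ℕ), (∀ j ∈ J, Even (m + 3 + j)) →
      (∀ j, 2 * j ≤ m + 3 → Even (m + 3 + j) → j ∈ J) →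
      nimisCard (fatCylinder 2 (m + 3)) = ∑ j ∈ J, sparseOrbitCount (m + 3) j := by
    rw [fatCylinder_two_eq_prismGraph]
    exact nimisCard_prismGraph hn
  have hsplit : ∀ (N : ℕ) (f : ℕ → ℕ), ∑ k ∈ Finset.range (N + 1), f k =
      f 0 + ∑ k ∈ Finset.Icc 1 N, f k := fun N f => by
    rw [Finset.range_eq_Ico, Finset.sum_eq_sum_Ico_succ_bot (Nat.succ_pos N)]
    rfl
  split_ifs with h
  · rw [key ((Finset.range ((m + 3) / 4 + 1)).image fun k => 2 * k),
      Finset.sum_image (by simp), hsplit]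
    · rw [mul_zero, sparseOrbitCount_zero]
      congr 1
      refine Finset.sum_congr rfl fun k hk => sparseOrbitCount_eq ?_ ?_ <;>
        (rw [Finset.mem_Icc] at hk; omega)
    · simp only [Finset.mem_image]
      rintro _ ⟨k, -, rfl⟩
      exact h.add (even_two_mul k)
    · intro j hj hj'
      obtain ⟨k, rfl⟩ := ((Nat.even_add.1 hj').1 h).two_dvd
      exact Finset.mem_image.2 ⟨k, Finset.mem_range.2 (by omega), rfl⟩
  · rw [key ((Finset.range ((m + 3 - 2) / 4 + 1)).image fun k => 2 * k + 1),
      Finset.sum_image (by simp), hsplit]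
    · rw [mul_zero, sparseOrbitCount_one (by omega)]
      congr 1
      refine Finset.sum_congr rfl fun k hk => sparseOrbitCount_eq ?_ ?_ <;>
        (rw [Finset.mem_Icc] at hk; omega)
    · simp only [Finset.mem_image]
      rintro _ ⟨k, -, rfl⟩
      exact (Nat.not_even_iff_odd.1 h).add_odd (odd_two_mul_add_one k)
    · intro j hj hj'
      obtain ⟨k, rfl⟩ : Odd j := by
        rw [← Nat.not_even_iff_odd]
        exact fun he => h ((Nat.even_add.1 hj').2 he)
      exact Finset.mem_image.2 ⟨k, Finset.mem_range.2 (by omega), rfl⟩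
end

section
/- For every n ≥ 1, the total MIS size of the grid graph G_{2×n} satisfies T(G_{2×n}) = (2/5)·[ n·F(n+2) + (n+2)·F(n) ]; equivalently, 5·T(G_{2×n}) = 2·( n·F(n+2) + (n+2)·F(n) ). -/
open SimpleGraph Finset

lemma isMaxIndep_iff_mem_iff {V : Type*} (G : SimpleGraph V) (s : Finset V) :
    IsMaxIndep G s ↔ ∀ x, x ∈ s ↔ ∀ y, G.Adj x y → y ∉ s := by
  classical
  constructor
  · rintro ⟨hind, hmax⟩ x
    refine ⟨fun hx y hxy hy => hind hx hy hxy, fun hx => ?_⟩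
    rw [hmax (insert x s) ?_ (Finset.subset_insert x s)]
    · exact Finset.mem_insert_self x s
    · intro u hu v hv huv
      rw [Finset.mem_insert] at hu hv
      rcases hu with rfl | hu <;> rcases hv with rfl | hv
      · exact G.loopless.irrefl _ huv
      · exact hx v huv hv
      · exact hx u huv.symm hu
      · exact hind hu hv huv
  · intro h
    refine ⟨fun u hu v hv huv => (h u).1 hu v huv hv, fun t ht hst => ?_⟩
    exact hst.antisymm fun x hx => (h x).2 fun y hxy hy => ht hx (hst hy) hxy

/-- `M` is a maximal independent set of the `2 × n` grid, the columns being the naturals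
below `n`. -/
def IsLadderMIS (n : ℕ) (M : Finset (Fin 2 × ℕ)) : Prop :=
  (∀ x ∈ M, x.2 < n) ∧
  ∀ j < n, ∀ i : Fin 2,
    (i, j) ∈ M ↔ (i + 1, j) ∉ M ∧ (i, j + 1) ∉ M ∧ ∀ k, k + 1 = j → (i, k) ∉ M

/-- The maximal independent sets of the `2 × (n + 1)` grid whose last column contains row `b`,
listed by deleting that last vertex. -/
def ladderMIS : ℕ → Fin 2 → Finset (Finset (Fin 2 × ℕ))
  | 0, b => {{(b, 0)}}
  | 1, b => {{(b + 1, 0), (b, 1)}}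
  | n + 2, b =>
    (ladderMIS (n + 1) (b + 1) ∪ ladderMIS n (b + 1)).image (insert (b, n + 2))

lemma fin_two_eq_or (b i : Fin 2) : i = b ∨ i = b + 1 := by
  revert b i; decide

lemma fin_two_add_one_add_one (b : Fin 2) : b + 1 + 1 = b := by
  revert b; decide

lemma fin_two_add_one_ne (b : Fin 2) : b + 1 ≠ b := by
  revert b; decide

lemma IsLadderMIS.last_column {n : ℕ} {M : Finset (Fin 2 × ℕ)} (h : IsLadderMIS (n + 1) M) :
    ∃ b, (b, n) ∈ M := by
  obtain ⟨hb, hM⟩ := h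
  by_contra! hn
  have out (i : Fin 2) : (i, n + 1) ∉ M := fun hi => absurd (hb _ hi) (by simp)
  have prev (i : Fin 2) : ∃ k, k + 1 = n ∧ (i, k) ∈ M := by
    by_contra! hk
    exact hn i ((hM n (by omega) i).2 ⟨hn _, out i, hk⟩)
  obtain ⟨k, hk, h0⟩ := prev 0
  obtain ⟨l, hl, h1⟩ := prev 1
  obtain rfl : k = l := by omega
  exact ((hM k (by omega) 0).1 h0).1 h1

lemma IsLadderMIS.insert_adjacent {n : ℕ} {M : Finset (Fin 2 × ℕ)} {b : Fin 2}
    (h : IsLadderMIS (n + 1) M) (hb : (b + 1, n) ∈ M) :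
    IsLadderMIS (n + 2) (insert (b, n + 1) M) := by
  obtain ⟨hlt, hM⟩ := h
  have h1 := fin_two_add_one_ne b
  have h2 := fin_two_add_one_add_one b
  refine ⟨by grind -ring, fun j hj i => ?_⟩
  have := hM n (by omega) b
  have := hM n (by omega) (b + 1)
  rcases fin_two_eq_or b i with rfl | rfl <;> rcases Nat.lt_or_ge j (n + 1) with hj' | hj' <;>
  grind -ring

lemma IsLadderMIS.insert_skip {n : ℕ} {M : Finset (Fin 2 × ℕ)} {b : Fin 2}
    (h : IsLadderMIS (n + 1) M) (hb : (b + 1, n) ∈ M) :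
    IsLadderMIS (n + 3) (insert (b, n + 2) M) := by
  obtain ⟨hlt, hM⟩ := h
  have h1 := fin_two_add_one_ne b
  have h2 := fin_two_add_one_add_one b
  refine ⟨by grind -ring, fun j hj i => ?_⟩
  have := hM n (by omega) b
  have := hM n (by omega) (b + 1)
  rcases fin_two_eq_or b i with rfl | rfl <;> rcases Nat.lt_or_ge j (n + 1) with hj' | hj' <;>
  grind -ring

lemma IsLadderMIS.erase_adjacent {n : ℕ} {M : Finset (Fin 2 × ℕ)} {b : Fin 2}
    (h : IsLadderMIS (n + 2) M) (hb : (b, n + 1) ∈ M) (hn : (b + 1, n) ∈ M) :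
    IsLadderMIS (n + 1) (M.erase (b, n + 1)) := by
  obtain ⟨hlt, hM⟩ := h
  have h1 := fin_two_add_one_ne b
  have h2 := fin_two_add_one_add_one b
  have := hM (n + 1) (by omega) b
  have := hM n (by omega) b
  have := hM n (by omega) (b + 1)
  refine ⟨fun ⟨i, j⟩ hx => ?_, fun j hj i => ?_⟩
  · have := hlt (i, j)
    rcases fin_two_eq_or b i with rfl | rfl <;> grind -ring
  · have := hM j (by omega) i
    rcases fin_two_eq_or b i with rfl | rfl <;> grind -ring

lemma IsLadderMIS.erase_skip {n : ℕ} {M : Finset (Fin 2 × ℕ)} {b : Fin 2}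
    (h : IsLadderMIS (n + 3) M) (hb : (b, n + 2) ∈ M) (hn : (b + 1, n + 1) ∉ M) :
    (b + 1, n) ∈ M ∧ IsLadderMIS (n + 1) (M.erase (b, n + 2)) := by
  obtain ⟨hlt, hM⟩ := h
  have h1 := fin_two_add_one_ne b
  have h2 := fin_two_add_one_add_one b
  have := hM (n + 2) (by omega) b
  have := hM (n + 1) (by omega) b
  have := hM (n + 1) (by omega) (b + 1)
  refine ⟨by grind -ring, fun ⟨i, j⟩ hx => ?_, fun j hj i => ?_⟩
  · have := hlt (i, j)
    rcases fin_two_eq_or b i with rfl | rfl <;> grind -ring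
  · have := hM j (by omega) i
    rcases fin_two_eq_or b i with rfl | rfl <;> grind -ring

lemma isLadderMIS_one_iff {M : Finset (Fin 2 × ℕ)} {b : Fin 2} :
    IsLadderMIS 1 M ∧ (b, 0) ∈ M ↔ M = {(b, 0)} := by
  have h1 := fin_two_add_one_ne b
  have h2 := fin_two_add_one_add_one b
  constructor
  · rintro ⟨⟨hlt, hM⟩, hb⟩
    have := hM 0 (by omega) b
    ext ⟨i, j⟩
    have := hlt (i, j)
    rcases fin_two_eq_or b i with rfl | rfl <;> grind -ring
  · rintro rfl
    refine ⟨⟨by simp, fun j hj i => ?_⟩, by simp⟩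
    rcases fin_two_eq_or b i with rfl | rfl <;> grind -ring

lemma mem_ladderMIS (n : ℕ) (b : Fin 2) (M : Finset (Fin 2 × ℕ)) :
    M ∈ ladderMIS n b ↔ IsLadderMIS (n + 1) M ∧ (b, n) ∈ M := by
  induction n using Nat.twoStepInduction generalizing b M with
  | zero => simp [ladderMIS, isLadderMIS_one_iff]
  | one =>
    rw [ladderMIS, Finset.mem_singleton]
    constructor
    · rintro rfl
      obtain ⟨h, hb⟩ := (isLadderMIS_one_iff (b := b + 1)).2 rfl
      rw [Finset.pair_comm]
      exact ⟨h.insert_adjacent hb, by simp⟩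
    · rintro ⟨h, hb⟩
      have hn : (b + 1, 0) ∈ M := by
        have := h.2 1 (by omega) b
        have := h.2 0 (by omega) (b + 1)
        have := h.2 1 (by omega) (b + 1)
        have := fin_two_add_one_add_one b
        grind -ring
      have := isLadderMIS_one_iff.1 ⟨h.erase_adjacent hb hn,
        Finset.mem_erase.2 ⟨by simp, hn⟩⟩
      rw [Finset.pair_comm, ← Finset.insert_erase hb, this]
  | more n ih0 ih1 =>
    simp only [ladderMIS, Finset.mem_image, Finset.mem_union, ih0, ih1]
    constructor
    · rintro ⟨N, ⟨hN, hb⟩ | ⟨hN, hb⟩, rfl⟩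
      · exact ⟨hN.insert_adjacent hb, by simp⟩
      · exact ⟨hN.insert_skip hb, by simp⟩
    · rintro ⟨h, hb⟩
      refine ⟨M.erase (b, n + 2), ?_, Finset.insert_erase hb⟩
      by_cases hn : (b + 1, n + 1) ∈ M
      · exact .inl ⟨h.erase_adjacent hb hn, Finset.mem_erase.2 ⟨by simp, hn⟩⟩
      · obtain ⟨hn', hN⟩ := h.erase_skip hb hn
        exact .inr ⟨hN, Finset.mem_erase.2 ⟨by simp, hn'⟩⟩

lemma notMem_of_mem_ladderMIS {n m : ℕ} {b i : Fin 2} {M : Finset (Fin 2 × ℕ)}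
    (hM : M ∈ ladderMIS n b) (hm : n < m) : (i, m) ∉ M := fun h => by
  have := ((mem_ladderMIS n b M).1 hM).1.1 _ h
  omega

lemma sum_ladderMIS_add_two (n : ℕ) (b : Fin 2) (f : ℕ → ℕ) :
    ∑ M ∈ ladderMIS (n + 2) b, f M.card =
      ∑ M ∈ ladderMIS (n + 1) (b + 1), f (M.card + 1) +
        ∑ M ∈ ladderMIS n (b + 1), f (M.card + 1) := by
  have hnot : ∀ M ∈ ladderMIS (n + 1) (b + 1) ∪ ladderMIS n (b + 1), (b, n + 2) ∉ M := by
    intro M hM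
    rcases Finset.mem_union.1 hM with h | h <;> exact notMem_of_mem_ladderMIS h (by omega)
  have hdisj : Disjoint (ladderMIS (n + 1) (b + 1)) (ladderMIS n (b + 1)) :=
    Finset.disjoint_left.2 fun M h h' =>
      notMem_of_mem_ladderMIS h' (Nat.lt_succ_self n) ((mem_ladderMIS _ _ _).1 h).2
  rw [ladderMIS, Finset.sum_image, ← Finset.sum_union hdisj]
  · exact Finset.sum_congr rfl fun M hM => by rw [Finset.card_insert_of_notMem (hnot M hM)]
  · intro M hM N hN hMN
    rw [← Finset.erase_insert (hnot M hM), ← Finset.erase_insert (hnot N hN)]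
    exact congrArg (Finset.erase · (b, n + 2)) hMN

lemma card_ladderMIS (n : ℕ) (b : Fin 2) : (ladderMIS n b).card = Nat.fib (n + 1) := by
  induction n using Nat.twoStepInduction generalizing b with
  | zero => simp [ladderMIS]
  | one => simp [ladderMIS]
  | more n ih0 ih1 =>
    have := sum_ladderMIS_add_two n b fun _ => 1
    simp only [Finset.sum_const, smul_eq_mul, mul_one, ih0, ih1] at this
    rw [this, Nat.fib_add_two (n := n + 1), add_comm]

lemma five_mul_sum_card_ladderMIS (n : ℕ) (b : Fin 2) :
    5 * ∑ M ∈ ladderMIS n b, M.card =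
      (n + 1) * Nat.fib (n + 3) + (n + 3) * Nat.fib (n + 1) := by
  induction n using Nat.twoStepInduction generalizing b with
  | zero => simp [ladderMIS, Nat.fib]
  | one =>
    rw [ladderMIS, Finset.sum_singleton, Finset.card_pair (by simp)]
    simp [Nat.fib]
  | more n ih0 ih1 =>
    rw [sum_ladderMIS_add_two n b fun k => k]
    simp only [Finset.sum_add_distrib, Finset.sum_const, smul_eq_mul, mul_one, mul_add,
      ih0, ih1, card_ladderMIS]
    simp only [Nat.fib_add_two (n := n + 3), Nat.fib_add_two (n := n + 2),
      Nat.fib_add_two (n := n + 1)]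
    ring

/-- The columns of the `2 × n` grid as natural numbers. -/
def gridEmbedding (n : ℕ) : Fin 2 × Fin n ↪ Fin 2 × ℕ :=
  (Function.Embedding.refl _).prodMap Fin.valEmbedding

lemma mem_map_gridEmbedding {n : ℕ} {M : Finset (Fin 2 × Fin n)} {i : Fin 2} {j : ℕ} :
    (i, j) ∈ M.map (gridEmbedding n) ↔ ∃ h : j < n, (i, ⟨j, h⟩) ∈ M := by
  simp only [Finset.mem_map, gridEmbedding, Function.Embedding.coe_prodMap, Prod.exists,
    Prod.map_apply, Function.Embedding.refl_apply, Fin.valEmbedding_apply, Prod.mk.injEq]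
  constructor
  · rintro ⟨a, k, h, rfl, rfl⟩
    exact ⟨k.2, h⟩
  · rintro ⟨h, hM⟩
    exact ⟨i, ⟨j, h⟩, hM, rfl, rfl⟩

lemma gridGraph_two_adj {n : ℕ} {i i' : Fin 2} {j j' : Fin n} :
    (gridGraph 2 n).Adj (i, j) (i', j') ↔
      (i' = i + 1 ∧ j' = j) ∨ (i' = i ∧ (j.val + 1 = j'.val ∨ j'.val + 1 = j.val)) := by
  rw [gridGraph, SimpleGraph.boxProd_adj, SimpleGraph.pathGraph_adj, SimpleGraph.pathGraph_adj]
  simp only [eq_comm (a := j'), eq_comm (a := i')]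
  fin_cases i <;> fin_cases i' <;> simp

lemma isMaxIndep_gridGraph_two_iff {n : ℕ} (M : Finset (Fin 2 × Fin n)) :
    IsMaxIndep (gridGraph 2 n) M ↔ IsLadderMIS n (M.map (gridEmbedding n)) := by
  rw [isMaxIndep_iff_mem_iff, IsLadderMIS]
  simp only [Prod.forall, mem_map_gridEmbedding, gridGraph_two_adj]
  constructor
  · intro h
    refine ⟨fun i j ⟨hj, _⟩ => hj, fun j hj i => ?_⟩
    have := h i ⟨j, hj⟩
    grind -ring
  · rintro ⟨-, h⟩ i ⟨j, hj⟩
    have := h j hj i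
    grind -ring

lemma map_misFinset_gridGraph_two (n : ℕ) :
    (misFinset (gridGraph 2 (n + 1))).map (Finset.mapEmbedding (gridEmbedding (n + 1))).toEmbedding
      = ladderMIS n 0 ∪ ladderMIS n 1 := by
  ext N
  simp only [Finset.mem_map, Finset.mem_union, mem_ladderMIS, misFinset, Finset.mem_filter,
    Finset.mem_univ, true_and, isMaxIndep_gridGraph_two_iff, RelEmbedding.coe_toEmbedding,
    Finset.mapEmbedding_apply]
  constructor
  · rintro ⟨M, hM, rfl⟩
    obtain ⟨b, hb⟩ := hM.last_column
    fin_cases b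
    · exact .inl ⟨hM, hb⟩
    · exact .inr ⟨hM, hb⟩
  · intro h
    have hN : IsLadderMIS (n + 1) N := h.elim And.left And.left
    have hmap : (N.preimage _ (gridEmbedding (n + 1)).injective.injOn).map
        (gridEmbedding (n + 1)) = N := by
      ext ⟨i, j⟩
      rw [mem_map_gridEmbedding]
      simp only [Finset.mem_preimage]
      exact ⟨fun ⟨_, h⟩ => h, fun h => ⟨hN.1 _ h, h⟩⟩
    exact ⟨_, hmap.symm ▸ hN, hmap⟩

lemma disjoint_ladderMIS (n : ℕ) : Disjoint (ladderMIS n 0) (ladderMIS n 1) := by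
  refine Finset.disjoint_left.2 fun M h0 h1 => ?_
  rw [mem_ladderMIS] at h0 h1
  exact ((h0.1.2 n (by omega) 0).1 h0.2).1 h1.2

theorem total_mis_size_grid_two_by_n (n : ℕ) (hn : 1 ≤ n) :
    5 * (∑ M ∈ misFinset (gridGraph 2 n), M.card) =
      2 * (n * Nat.fib (n + 2) + (n + 2) * Nat.fib n) := by
  obtain ⟨n, rfl⟩ := Nat.exists_eq_add_of_le' hn
  have h : ∑ M ∈ misFinset (gridGraph 2 (n + 1)), M.card =
      ∑ N ∈ ladderMIS n 0 ∪ ladderMIS n 1, N.card := by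
    rw [← map_misFinset_gridGraph_two, Finset.sum_map]
    simp
  rw [h, Finset.sum_union (disjoint_ladderMIS n), mul_add, five_mul_sum_card_ladderMIS,
    five_mul_sum_card_ladderMIS, ← two_mul]
end

section
/- For every n ≥ 1, the number of length-n binary strings that contain no two adjacent 0's and contain an even number of 1's equals ⌊F(n+3)/2⌋ − ⌊F(n+1)/2⌋. -/
/-- No two adjacent entries of `f` are both zero. -/
def NoAdjacentZeros {n : ℕ} (f : Fin n → Fin 2) : Prop :=
  ∀ i j : Fin n, (i : ℕ) + 1 = j → ¬(f i = 0 ∧ f j = 0)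

/-- The number of entries of `f` equal to one. -/
def onesCount {n : ℕ} (f : Fin n → Fin 2) : ℕ :=
  (Finset.univ.filter (fun i : Fin n => f i = 1)).card

open scoped Classical in
/-- The number of length-`n` binary strings with no two adjacent zeros in which the number of ones
has the same parity as `p`. -/
noncomputable def noAdjacentZerosCount (n p : ℕ) : ℕ :=
  ∑ f : Fin n → Fin 2, if NoAdjacentZeros f ∧ Even (onesCount f + p) then 1 else 0

theorem Fin.sum_function_cons {α M : Type*} [Fintype α] [AddCommMonoid M] (n : ℕ)
    (g : (Fin (n + 1) → α) → M) :
    ∑ f, g f = ∑ a : α, ∑ f : Fin n → α, g (Fin.cons a f : Fin (n + 1) → α) := by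
  rw [← Fintype.sum_prod_type', ← (Fin.consEquiv fun _ : Fin (n + 1) => α).sum_comp]
  rfl

theorem onesCount_cons {n : ℕ} (a : Fin 2) (f : Fin n → Fin 2) :
    onesCount (Fin.cons a f : Fin (n + 1) → Fin 2) = (if a = 1 then 1 else 0) + onesCount f := by
  simp only [onesCount, Finset.card_filter, Fin.sum_univ_succ, Fin.cons_zero, Fin.cons_succ]

theorem noAdjacentZeros_cons_one {n : ℕ} (f : Fin n → Fin 2) :
    NoAdjacentZeros (Fin.cons 1 f : Fin (n + 1) → Fin 2) ↔ NoAdjacentZeros f := by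
  simp [NoAdjacentZeros, Fin.forall_fin_succ]

theorem noAdjacentZeros_cons_zero {n : ℕ} (f : Fin (n + 1) → Fin 2) :
    NoAdjacentZeros (Fin.cons 0 f : Fin (n + 1 + 1) → Fin 2) ↔ f 0 ≠ 0 ∧ NoAdjacentZeros f := by
  simp [NoAdjacentZeros, Fin.forall_fin_succ]

theorem noAdjacentZeros_of_le_one {n : ℕ} (hn : n ≤ 1) (f : Fin n → Fin 2) :
    NoAdjacentZeros f :=
  fun i j h => by omega

theorem noAdjacentZerosCount_add_two (n p : ℕ) :
    noAdjacentZerosCount (n + 2) p =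
      noAdjacentZerosCount n (p + 1) + noAdjacentZerosCount (n + 1) (p + 1) := by
  classical
  unfold noAdjacentZerosCount
  rw [Fin.sum_function_cons, Fin.sum_univ_two]
  congr 1
  · rw [Fin.sum_function_cons, Fin.sum_univ_two, Finset.sum_eq_zero, zero_add]
    · refine Finset.sum_congr rfl fun f _ => if_congr ?_ rfl rfl
      simp [noAdjacentZeros_cons_zero, noAdjacentZeros_cons_one, onesCount_cons, add_comm,
        add_left_comm]
    · exact fun f _ => if_neg fun h => ((noAdjacentZeros_cons_zero _).1 h.1).1 rfl
  · refine Finset.sum_congr rfl fun f _ => if_congr ?_ rfl rfl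
    simp [noAdjacentZeros_cons_one, onesCount_cons, add_comm, add_left_comm]

theorem noAdjacentZerosCount_parity_add_two (n p : ℕ) :
    noAdjacentZerosCount n (p + 2) = noAdjacentZerosCount n p := by
  classical
  refine Finset.sum_congr rfl fun f _ => if_congr ?_ rfl rfl
  simp only [← add_assoc, Nat.even_add, even_two, iff_true]

theorem noAdjacentZerosCount_zero (p : ℕ) :
    noAdjacentZerosCount 0 p = if Even p then 1 else 0 := by
  simp [noAdjacentZerosCount, noAdjacentZeros_of_le_one, onesCount]

theorem noAdjacentZerosCount_one (p : ℕ) : noAdjacentZerosCount 1 p = 1 := by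
  have h (a : Fin 2) (f : Fin 0 → Fin 2) :
      onesCount (Fin.cons a f : Fin 1 → Fin 2) = if a = 1 then 1 else 0 := by
    rw [onesCount_cons]
    simp [onesCount]
  classical
  unfold noAdjacentZerosCount
  rw [Fin.sum_function_cons, Fin.sum_univ_two, Fintype.sum_unique, Fintype.sum_unique, h, h]
  by_cases hp : Even p <;> simp [noAdjacentZeros_of_le_one, hp, Nat.even_add]

theorem noAdjacentZerosCount_add_eq_fib (n : ℕ) :
    noAdjacentZerosCount n 0 + noAdjacentZerosCount n 1 = Nat.fib (n + 2) := by
  induction n using Nat.twoStepInduction with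
  | zero => simp [noAdjacentZerosCount_zero]
  | one => simp [noAdjacentZerosCount_one, Nat.fib_add_two]
  | more n ih₀ ih₁ =>
    have h₀ := noAdjacentZerosCount_parity_add_two n 0
    have h₁ := noAdjacentZerosCount_parity_add_two (n + 1) 0
    have hf := Nat.fib_add_two (n := n + 2)
    simp only [noAdjacentZerosCount_add_two, Nat.reduceAdd, zero_add, add_assoc] at *
    omega

/-- The difference between the even and the odd counts is `1, 0, -1`, repeating with period `3`. -/
theorem noAdjacentZerosCount_sub (n : ℕ) :
    (noAdjacentZerosCount n 0 : ℤ) - noAdjacentZerosCount n 1 = 1 - (n % 3 : ℕ) := by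
  induction n using Nat.twoStepInduction with
  | zero => simp [noAdjacentZerosCount_zero]
  | one => simp [noAdjacentZerosCount_one]
  | more n ih₀ ih₁ =>
    have h₀ := noAdjacentZerosCount_parity_add_two n 0
    have h₁ := noAdjacentZerosCount_parity_add_two (n + 1) 0
    simp only [noAdjacentZerosCount_add_two, Nat.reduceAdd, zero_add] at *
    omega

theorem Nat.fib_mod_two (n : ℕ) : Nat.fib n % 2 = if n % 3 = 0 then 0 else 1 := by
  induction n using Nat.twoStepInduction with
  | zero => rfl
  | one => rfl
  | more n ih₀ ih₁ =>
    rw [Nat.fib_add_two]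
    split_ifs at * <;> omega

theorem count_even_ones_no_adjacent_zeros (n : ℕ) (hn : 1 ≤ n) :
    Nat.card {f : Fin n → Fin 2 //
        (∀ i : ℕ, ∀ h : i + 1 < n, ¬(f ⟨i, by omega⟩ = 0 ∧ f ⟨i + 1, h⟩ = 0)) ∧
        Even (Finset.univ.filter (fun i : Fin n => f i = 1)).card} =
      Nat.fib (n + 3) / 2 - Nat.fib (n + 1) / 2 := by
  classical
  have hcard : Nat.card {f : Fin n → Fin 2 //
        (∀ i : ℕ, ∀ h : i + 1 < n, ¬(f ⟨i, by omega⟩ = 0 ∧ f ⟨i + 1, h⟩ = 0)) ∧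
        Even (Finset.univ.filter (fun i : Fin n => f i = 1)).card} =
      noAdjacentZerosCount n 0 := by
    rw [Nat.card_eq_fintype_card, Fintype.card_subtype, Finset.card_filter]
    refine Finset.sum_congr rfl fun f _ => if_congr (and_congr ?_ Iff.rfl) rfl rfl
    exact ⟨fun H i j hij => by
      obtain ⟨j, hj⟩ := j
      obtain rfl : (i : ℕ) + 1 = j := hij
      exact H i hj, fun H i h => H _ _ rfl⟩
  rw [hcard]
  have hsum := noAdjacentZerosCount_add_eq_fib n
  have hsub := noAdjacentZerosCount_sub n
  have hfib := Nat.fib_add_two (n := n + 1)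
  have hpar₁ := Nat.fib_mod_two (n + 1)
  have hpar₂ := Nat.fib_mod_two (n + 2)
  simp only [add_assoc, Nat.reduceAdd] at hfib
  split_ifs at * <;> omega
end
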